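/- arXiv:2404.12844 — 3 statements merged into one kernel-verified Lean document; each statement's English description precedes it below -/
import Mathlib

section
/- Let K be a number field such that [K : ℚ] is odd. Then there exist w, x, y, z ∈ 𝓞_K with 15 = w² + 2x² + 5y² + 5z² if and only if K is not totally real. -/
open NumberField

theorem Int.isSquare_of_isSquare_pow_odd {m : ℤ} {n : ℕ} (hn : Odd n) (h : IsSquare (m ^ n)) :
    IsSquare m := by
  obtain ⟨k, rfl⟩ := hn
  obtain ⟨s, hs⟩ := h
  rcases eq_or_ne m 0 with rfl | hm
  · exact ⟨0, by simp⟩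
  have h1 : (m ^ k) ^ 2 ∣ s ^ 2 := ⟨m, by rw [pow_two s, ← hs]; ring⟩
  obtain ⟨c, rfl⟩ := (Int.pow_dvd_pow_iff two_ne_zero).1 h1
  refine ⟨c, mul_left_cancel₀ (pow_ne_zero 2 (pow_ne_zero k hm)) ?_⟩
  linear_combination hs

theorem five_dvd_of_sq_add_two_mul_sq (k : ℕ) :
    ∀ a b v : ℤ, a ^ 2 + 2 * b ^ 2 = 5 ^ (2 * k + 1) * v → 5 ∣ v := by
  have key : ∀ a b : ℤ, 5 ∣ a ^ 2 + 2 * b ^ 2 → 5 ∣ a ∧ 5 ∣ b := by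
    intro a b h
    have h' : ((a : ZMod 5)) ^ 2 + 2 * (b : ZMod 5) ^ 2 = 0 := by
      have := (ZMod.intCast_zmod_eq_zero_iff_dvd (a ^ 2 + 2 * b ^ 2) 5).2 (by exact_mod_cast h)
      simpa using this
    have := (by decide : ∀ a b : ZMod 5, a ^ 2 + 2 * b ^ 2 = 0 → a = 0 ∧ b = 0) _ _ h'
    exact ⟨by exact_mod_cast (ZMod.intCast_zmod_eq_zero_iff_dvd a 5).1 this.1,
      by exact_mod_cast (ZMod.intCast_zmod_eq_zero_iff_dvd b 5).1 this.2⟩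
  induction k with
  | zero =>
    intro a b v h
    obtain ⟨⟨c, rfl⟩, ⟨d, rfl⟩⟩ := key a b ⟨v, by rw [h]; ring⟩
    exact ⟨c ^ 2 + 2 * d ^ 2, by norm_num at h; linarith⟩
  | succ k ih =>
    intro a b v h
    obtain ⟨⟨c, rfl⟩, ⟨d, rfl⟩⟩ := key a b ⟨5 ^ (2 * k + 2) * v, by rw [h]; ring⟩
    refine ih c d v ?_
    have : (25 : ℤ) * (c ^ 2 + 2 * d ^ 2) = 25 * (5 ^ (2 * k + 1) * v) := by
      linear_combination h
    linarith

section OddDegree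

variable {K : Type} [Field K] [NumberField K]

theorem isSquare_of_sq_eq_intCast (hodd : Odd (Module.finrank ℚ K)) {y : 𝓞 K} {m : ℤ}
    (h : y ^ 2 = m) : IsSquare m := by
  refine Int.isSquare_of_isSquare_pow_odd hodd ⟨Algebra.norm ℤ y, ?_⟩
  rw [← pow_two, ← map_pow, h, ← RingOfIntegers.rank K]
  exact (Algebra.norm_algebraMap (S := 𝓞 K) m).symm

theorem five_dvd_of_sq_add_two_mul_sq_eq (hodd : Odd (Module.finrank ℚ K)) {w x : 𝓞 K} {u : ℤ}
    (h : w ^ 2 + 2 * x ^ 2 = ((5 * u : ℤ) : 𝓞 K)) : 5 ∣ u := by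
  classical
  let b := RingOfIntegers.basis K
  let f : 𝓞 K →ₐ[ℤ] _ := Algebra.leftMulMatrix b
  let c : ℤ →+* ℤ√(-2) := Int.castRingHom _
  let s : ℤ√(-2) := ⟨0, 1⟩
  have hs : s * s = -2 := by ext <;> simp [s]
  let P := c.mapMatrix (f w) + s • c.mapMatrix (f x)
  let Q := c.mapMatrix (f w) - s • c.mapMatrix (f x)
  have hcomm : c.mapMatrix (f w) * c.mapMatrix (f x) = c.mapMatrix (f x) * c.mapMatrix (f w) := by
    rw [← map_mul, ← map_mul, ← map_mul, ← map_mul, mul_comm]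
  have hPQ : P * Q = ((5 * u : ℤ) : ℤ√(-2)) • 1 := by
    have h1 : P * Q = c.mapMatrix (f (w ^ 2 + 2 * x ^ 2)) := by
      have e : (s • c.mapMatrix (f x)) * (s • c.mapMatrix (f x)) =
          -(2 * (c.mapMatrix (f x) * c.mapMatrix (f x))) := by
        rw [smul_mul_smul_comm, hs, neg_smul, ofNat_smul_eq_nsmul, two_nsmul, two_mul]
      have e' := (show Commute (c.mapMatrix (f w)) (c.mapMatrix (f x)) from
        hcomm).smul_right s |>.mul_self_sub_mul_self_eq
      rw [e, sub_neg_eq_add] at e'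
      rw [← e', map_add, map_add, map_mul, map_mul, map_pow, map_pow, map_pow, map_ofNat, map_ofNat,
        pow_two, pow_two, map_mul c.mapMatrix (f x)]
    rw [h1, h]
    rw [map_intCast, map_intCast, Int.cast_smul_eq_zsmul, zsmul_one]
  let st : ℤ√(-2) →+* ℤ√(-2) := starRingEnd _
  have hst : st P.det = Q.det := by
    rw [RingHom.map_det]
    congr 1
    ext i j
    · simp [P, Q, st, s, c, starRingEnd_apply]
    · simp [P, Q, st, s, c, starRingEnd_apply]
  have hdet : P.det * st P.det = ((5 * u : ℤ) : ℤ√(-2)) ^ Module.finrank ℚ K := by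
    rw [hst, ← Matrix.det_mul, hPQ, Matrix.det_smul, Matrix.det_one, mul_one,
      ← Module.finrank_eq_card_chooseBasisIndex, RingOfIntegers.rank]
  have hnorm : P.det.re ^ 2 + 2 * P.det.im ^ 2 = (5 * u) ^ Module.finrank ℚ K := by
    have := congrArg Zsqrtd.re hdet
    rw [← Int.cast_pow, Zsqrtd.re_intCast] at this
    simp [st, starRingEnd_apply] at this
    linarith
  obtain ⟨k, hk⟩ := hodd
  rw [hk, mul_pow] at hnorm
  exact (by norm_num : Prime (5 : ℤ)).dvd_of_dvd_pow
    (five_dvd_of_sq_add_two_mul_sq k _ _ _ hnorm)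

theorem eq_zero_of_forall_norm_lt_one {t : 𝓞 K} (h : ∀ σ : K →+* ℂ, ‖σ t‖ < 1) : t = 0 := by
  by_contra ht
  obtain ⟨w⟩ : Nonempty (InfinitePlace K) := inferInstance
  have h1 : ∀ w : InfinitePlace K, w t < 1 := fun w => by
    rw [← InfinitePlace.norm_embedding_eq]; exact h _
  exact absurd (InfinitePlace.one_le_of_lt_one ht fun z _ => h1 z) (not_le.2 (h1 w))

theorem sq_eq_zero_or_one_of_sq_le_three (hodd : Odd (Module.finrank ℚ K)) {y : 𝓞 K}
    (h : ∀ σ : K →+* ℂ, ∃ r : ℝ, σ y = r ∧ r ^ 2 ≤ 3) : y ^ 2 = 0 ∨ y ^ 2 = 1 := by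
  have h0 : y ^ 2 * (y ^ 2 - 1) * (y ^ 2 - 2) * (y ^ 2 - 3) * ((y ^ 2) ^ 2 - 3 * y ^ 2 + 1) = 0 := by
    refine eq_zero_of_forall_norm_lt_one fun σ => ?_
    obtain ⟨r, hr, hr3⟩ := h σ
    have e : σ ((y ^ 2 * (y ^ 2 - 1) * (y ^ 2 - 2) * (y ^ 2 - 3) *
        ((y ^ 2) ^ 2 - 3 * y ^ 2 + 1) : 𝓞 K) : K) =
        ((r ^ 2 * (r ^ 2 - 1) * (r ^ 2 - 2) * (r ^ 2 - 3) * ((r ^ 2) ^ 2 - 3 * r ^ 2 + 1) : ℝ) : ℂ) := by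
      push_cast
      simp only [map_mul, map_sub, map_pow, map_add, map_ofNat, map_one, hr]
    rw [e, Complex.norm_real, Real.norm_eq_abs]
    obtain ⟨s, hs⟩ : ∃ s, s = (r ^ 2) ^ 2 - 3 * r ^ 2 + 1 := ⟨_, rfl⟩
    have hs1 : s ≤ 1 := by nlinarith [sq_nonneg r]
    have hs2 : -5 / 4 ≤ s := by nlinarith [sq_nonneg (r ^ 2 - 3 / 2)]
    have : r ^ 2 * (r ^ 2 - 1) * (r ^ 2 - 2) * (r ^ 2 - 3) * ((r ^ 2) ^ 2 - 3 * r ^ 2 + 1) =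
        s ^ 3 - s := by rw [hs]; ring
    rw [this, abs_lt]
    constructor
    · nlinarith [mul_nonneg (sub_nonneg.2 hs2) (sq_nonneg (s - 1 / 2)), sq_nonneg (s - 1/2)]
    · nlinarith [mul_nonneg (sub_nonneg.2 hs1) (sq_nonneg (s + 1 / 2)), sq_nonneg (s + 1/2)]
  have nsq : ∀ {z : 𝓞 K} {m : ℤ}, ¬ IsSquare m → z ^ 2 = m → False := fun hm hz =>
    hm (isSquare_of_sq_eq_intCast hodd hz)
  simp only [mul_eq_zero, sub_eq_zero] at h0
  obtain (((h0 | h0) | h0) | h0) | h0 := h0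
  · exact Or.inl h0
  · exact Or.inr h0
  · exact (nsq (m := 2) (Int.prime_iff_natAbs_prime.2 (by norm_num)).not_isSquare (by simpa using h0)).elim
  · exact (nsq (m := 3) (Int.prime_iff_natAbs_prime.2 (by norm_num)).not_isSquare (by simpa using h0)).elim
  · refine (nsq (z := 2 * y ^ 2 - 3) (m := 5) (Int.prime_iff_natAbs_prime.2 (by norm_num)).not_isSquare ?_).elim
    push_cast
    linear_combination 4 * h0

theorem sum_ne_fifteen_of_totallyReal (hodd : Odd (Module.finrank ℚ K))
    (hreal : ∀ σ : K →+* ℂ, ∀ x : K, (σ x).im = 0) (w x y z : 𝓞 K) :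
    (15 : 𝓞 K) ≠ w ^ 2 + 2 * x ^ 2 + 5 * y ^ 2 + 5 * z ^ 2 := by
  intro h
  have hre : ∀ (σ : K →+* ℂ) (t : K), σ t = ((σ t).re : ℂ) := fun σ t =>
    Complex.ext rfl (by simpa using hreal σ t)
  have hσ : ∀ σ : K →+* ℂ, (15 : ℝ) = (σ w).re ^ 2 + 2 * (σ x).re ^ 2 + 5 * (σ y).re ^ 2 +
      5 * (σ z).re ^ 2 := by
    intro σ
    have := congrArg (fun t : 𝓞 K => σ t) h
    simp only [map_add, map_mul, map_pow, map_ofNat] at this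
    rw [hre σ w, hre σ x, hre σ y, hre σ z] at this
    exact_mod_cast this
  have hy := sq_eq_zero_or_one_of_sq_le_three hodd (y := y) fun σ => ⟨_, hre σ y, by
    nlinarith [hσ σ, sq_nonneg (σ w).re, sq_nonneg (σ x).re, sq_nonneg (σ z).re]⟩
  have hz := sq_eq_zero_or_one_of_sq_le_three hodd (y := z) fun σ => ⟨_, hre σ z, by
    nlinarith [hσ σ, sq_nonneg (σ w).re, sq_nonneg (σ x).re, sq_nonneg (σ y).re]⟩
  have key : ∀ u : ℤ, ¬ 5 ∣ u → w ^ 2 + 2 * x ^ 2 ≠ ((5 * u : ℤ) : 𝓞 K) := fun u hu he =>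
    hu (five_dvd_of_sq_add_two_mul_sq_eq hodd he)
  rcases hy with hy | hy <;> rcases hz with hz | hz <;> rw [hy, hz] at h
  · exact key 3 (by norm_num) (by push_cast; linear_combination -h)
  · exact key 2 (by norm_num) (by push_cast; linear_combination -h)
  · exact key 2 (by norm_num) (by push_cast; linear_combination -h)
  · exact key 1 (by norm_num) (by push_cast; linear_combination -h)

end OddDegree

theorem sq_ne_neg_ten_of_odd_finrank {K : Type} [Field K] [NumberField K]
    (hodd : Odd (Module.finrank ℚ K)) (r : K) : r ^ 2 ≠ -10 := by
  intro h
  have h1 : (Algebra.norm ℚ r) ^ 2 = (-10) ^ Module.finrank ℚ K := by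
    rw [← map_pow, h, ← Algebra.norm_algebraMap (S := K) (-10 : ℚ)]
    simp
  have h2 : ((-10 : ℚ)) ^ Module.finrank ℚ K < 0 := hodd.pow_neg (by norm_num)
  nlinarith [sq_nonneg (Algebra.norm ℚ r)]

/-- The ring `K(√-10)`. -/
abbrev AdjoinSqrtNegTen (K : Type) [Field K] : Type := QuadraticAlgebra K (-10) 0

/-- For `K` with a nonreal embedding, the Pell equation over `𝓞 K` has nontrivial solutions
that are arbitrarily close to `(1, 0)` at `13`. -/
theorem exists_pell {K : Type} [Field K] [NumberField K]
    (hodd : Odd (Module.finrank ℚ K)) (φ : K →+* ℂ) {x₀ : K} (hφ : (φ x₀).im ≠ 0) :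
    ∃ X Y a b : 𝓞 K, X ^ 2 + 10 * Y ^ 2 = 1 ∧ Y ≠ 0 ∧ X = 1 + 13 * a ∧ Y = 13 * b := by
  have : Fact (∀ r : K, r ^ 2 ≠ (-10) + 0 * r) :=
    ⟨fun r => by simpa using sq_ne_neg_ten_of_odd_finrank hodd r⟩
  have : NumberField (AdjoinSqrtNegTen K) :=
    { to_charZero := inferInstance
      to_finiteDimensional := Module.Finite.trans K (AdjoinSqrtNegTen K) }
  let ψ : AdjoinSqrtNegTen K →+* ℂ :=
    letI := φ.toAlgebra
    ((QuadraticAlgebra.lift (R := K) (A := ℂ) (a := -10) (b := 0)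
      ⟨Complex.I * (Real.sqrt 10 : ℝ), by
        rw [Algebra.smul_def, mul_mul_mul_comm, Complex.I_mul_I, ← Complex.ofReal_mul,
          Real.mul_self_sqrt (by norm_num), RingHom.algebraMap_toAlgebra, map_neg, map_ofNat]
        simp⟩ : AdjoinSqrtNegTen K →ₐ[K] ℂ) : AdjoinSqrtNegTen K →+* ℂ)
  have hψ : ∀ x : K, ψ (algebraMap K (AdjoinSqrtNegTen K) x) = φ x := fun x => by
    let := φ.toAlgebra
    exact AlgHom.commutes (QuadraticAlgebra.lift (R := K) (A := ℂ) (a := -10) (b := 0) _) x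
  let σ : AdjoinSqrtNegTen K →+* AdjoinSqrtNegTen K := starRingEnd (AdjoinSqrtNegTen K)
  have hσ : ∀ x : AdjoinSqrtNegTen K, σ x = ⟨x.re, -x.im⟩ := fun x => by
    refine QuadraticAlgebra.ext ?_ ?_ <;> simp [σ, starRingEnd_apply]
  have hσσ : ∀ x, σ (σ x) = x := fun x => by simp [hσ]
  let w₁ := InfinitePlace.mk ψ
  let w₂ := InfinitePlace.mk (ψ.comp σ)
  have hne : w₂ ≠ w₁ := by
    intro h
    rcases InfinitePlace.mk_eq_iff.1 h with h | h
    · have := DFunLike.congr_fun h (⟨0, 1⟩ : AdjoinSqrtNegTen K)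
      rw [RingHom.comp_apply, hσ] at this
      have h2 : (⟨-0, -1⟩ : AdjoinSqrtNegTen K) = -⟨0, 1⟩ := rfl
      have h3 : (⟨0, -1⟩ : AdjoinSqrtNegTen K) = -⟨0, 1⟩ := by ext <;> simp
      rw [h3, map_neg] at this
      have h0 : ψ (⟨0, 1⟩ : AdjoinSqrtNegTen K) = 0 := by linear_combination (-1 / 2 : ℂ) * this
      rw [map_eq_zero] at h0
      exact one_ne_zero (congrArg QuadraticAlgebra.im h0)
    · have := DFunLike.congr_fun h (algebraMap K (AdjoinSqrtNegTen K) x₀)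
      rw [ComplexEmbedding.conjugate_coe_eq, RingHom.comp_apply, hσ] at this
      have h3 : (⟨(algebraMap K (AdjoinSqrtNegTen K) x₀).re, -(algebraMap K (AdjoinSqrtNegTen K) x₀).im⟩ : AdjoinSqrtNegTen K) = algebraMap K (AdjoinSqrtNegTen K) x₀ := by
        ext <;> simp
      rw [h3, hψ, Complex.conj_eq_iff_im] at this
      exact hφ this
  obtain ⟨u, hu⟩ := Units.dirichletUnitTheorem.exists_unit (AdjoinSqrtNegTen K) w₁
  let σ' : 𝓞 (AdjoinSqrtNegTen K) →+* 𝓞 (AdjoinSqrtNegTen K) := RingOfIntegers.mapRingHom σ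
  have hσ' : ∀ x : 𝓞 (AdjoinSqrtNegTen K), ((σ' x : 𝓞 (AdjoinSqrtNegTen K)) : AdjoinSqrtNegTen K) = σ x := fun x => rfl
  have hlt : ∀ w : InfinitePlace (AdjoinSqrtNegTen K), w ≠ w₁ → w (u : 𝓞 (AdjoinSqrtNegTen K)) < 1 := fun w hw => by
    have h0 : 0 < w (u : 𝓞 (AdjoinSqrtNegTen K)) := w.pos_iff.2 (by simp)
    exact (Real.log_neg_iff h0).1 (hu w hw)
  let t : (𝓞 (AdjoinSqrtNegTen K))ˣ := u * (Units.map (σ' : 𝓞 (AdjoinSqrtNegTen K) →* 𝓞 (AdjoinSqrtNegTen K)) u)⁻¹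
  have htu : t * Units.map (σ' : 𝓞 (AdjoinSqrtNegTen K) →* 𝓞 (AdjoinSqrtNegTen K)) u = u := inv_mul_cancel_right _ _
  have htors : ∀ e : ℕ, 0 < e → t ^ e ≠ 1 := by
    intro e he h
    have h1 : u ^ e = Units.map (σ' : 𝓞 (AdjoinSqrtNegTen K) →* 𝓞 (AdjoinSqrtNegTen K)) u ^ e := by
      conv_lhs => rw [← htu, mul_pow, h, one_mul]
    have h2 : w₁ (u : 𝓞 (AdjoinSqrtNegTen K)) ^ e = w₂ (u : 𝓞 (AdjoinSqrtNegTen K)) ^ e := by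
      have := congrArg (fun v : (𝓞 (AdjoinSqrtNegTen K))ˣ => w₁ ((v : 𝓞 (AdjoinSqrtNegTen K)) : AdjoinSqrtNegTen K)) h1
      simp only [Units.val_pow_eq_pow_val, map_pow, Units.coe_map, MonoidHom.coe_coe,
        hσ'] at this
      exact this
    have h3 := (pow_left_inj₀ (apply_nonneg w₁ _) (apply_nonneg w₂ _) he.ne').1 h2
    have h4 := InfinitePlace.one_le_of_lt_one (w := w₁) (a := (u : 𝓞 (AdjoinSqrtNegTen K))) u.ne_zero
      fun w hw => hlt w hw
    exact absurd (h3 ▸ h4) (not_le.2 (hlt w₂ hne))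
  have hnorm : t * Units.map (σ' : 𝓞 (AdjoinSqrtNegTen K) →* 𝓞 (AdjoinSqrtNegTen K)) t = 1 := by
    have : Units.map (σ' : 𝓞 (AdjoinSqrtNegTen K) →* 𝓞 (AdjoinSqrtNegTen K)) (Units.map (σ' : 𝓞 (AdjoinSqrtNegTen K) →* 𝓞 (AdjoinSqrtNegTen K)) u) = u := by
      refine Units.ext (RingOfIntegers.ext (hσσ _))
    rw [map_mul, map_inv, this, ← mul_assoc, htu, mul_inv_cancel]
  have : Finite (𝓞 (AdjoinSqrtNegTen K) ⧸ Ideal.span {(260 : 𝓞 (AdjoinSqrtNegTen K))}) :=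
    Ideal.finiteQuotientOfFreeOfNeBot _ (by simp)
  obtain ⟨e, he, hte⟩ := isOfFinOrder_iff_pow_eq_one.1 (isOfFinOrder_of_finite
    (Units.map (Ideal.Quotient.mk (Ideal.span {(260 : 𝓞 (AdjoinSqrtNegTen K))}) : 𝓞 (AdjoinSqrtNegTen K) →* 𝓞 (AdjoinSqrtNegTen K) ⧸ Ideal.span {(260 : 𝓞 (AdjoinSqrtNegTen K))}) t))
  obtain ⟨η, hη⟩ : ∃ η : 𝓞 (AdjoinSqrtNegTen K), ((t ^ e : (𝓞 (AdjoinSqrtNegTen K))ˣ) : 𝓞 (AdjoinSqrtNegTen K)) = 1 + 260 * η := by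
    have := congrArg Units.val hte
    rw [← map_pow, Units.coe_map, MonoidHom.coe_coe, Units.val_one,
      ← map_one (Ideal.Quotient.mk _), Ideal.Quotient.eq, Ideal.mem_span_singleton] at this
    obtain ⟨η, h⟩ := this
    exact ⟨η, by rw [← h]; ring⟩
  obtain ⟨V, hV⟩ : ∃ V : AdjoinSqrtNegTen K, V = (((t ^ e : (𝓞 (AdjoinSqrtNegTen K))ˣ) : 𝓞 (AdjoinSqrtNegTen K)) : AdjoinSqrtNegTen K) := ⟨_, rfl⟩
  have hV1 : V.re ^ 2 + 10 * V.im ^ 2 = 1 := by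
    have h1 : V * σ V = 1 := by
      have := congrArg (fun v : (𝓞 (AdjoinSqrtNegTen K))ˣ => ((v : 𝓞 (AdjoinSqrtNegTen K)) : AdjoinSqrtNegTen K)) (congrArg (· ^ e) hnorm)
      simp only [mul_pow, ← map_pow] at this
      rw [hV]
      simpa [hσ'] using this
    rw [hσ, ← map_one (algebraMap K (AdjoinSqrtNegTen K))] at h1
    have := congrArg QuadraticAlgebra.re h1
    simp only [QuadraticAlgebra.re_mul, QuadraticAlgebra.algebraMap_re] at this
    linear_combination this
  have hVη : V = algebraMap K (AdjoinSqrtNegTen K) 1 +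
      algebraMap K (AdjoinSqrtNegTen K) 260 * (η : AdjoinSqrtNegTen K) := by
    rw [hV, hη, map_one, map_ofNat]; push_cast; rfl
  have hcoord_one : IsIntegral ℤ (2 * (η : AdjoinSqrtNegTen K).re) := by
    rw [← isIntegral_algebraMap_iff (algebraMap K (AdjoinSqrtNegTen K)).injective]
    have : algebraMap K (AdjoinSqrtNegTen K) (2 * (η : AdjoinSqrtNegTen K).re) = (η : AdjoinSqrtNegTen K) + σ' η := by
      rw [hσ', hσ]
      ext <;> simp [two_mul]
    rw [this]
    exact η.isIntegral_coe.add (σ' η).isIntegral_coe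
  have hint2 : IsIntegral ℤ (20 * (η : AdjoinSqrtNegTen K).im) := by
    rw [← isIntegral_algebraMap_iff (algebraMap K (AdjoinSqrtNegTen K)).injective]
    have : algebraMap K (AdjoinSqrtNegTen K) (20 * (η : AdjoinSqrtNegTen K).im) = ⟨0, -1⟩ * ((η : AdjoinSqrtNegTen K) - σ' η) := by
      rw [hσ', hσ]
      ext <;> simp
      ring
    rw [this]
    refine IsIntegral.mul ?_ (η.isIntegral_coe.sub (σ' η).isIntegral_coe)
    refine IsIntegral.of_pow (n := 2) two_pos ?_
    have : (⟨0, -1⟩ : AdjoinSqrtNegTen K) ^ 2 = algebraMap K (AdjoinSqrtNegTen K) (-10) := by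
      rw [pow_two]; ext <;> simp
    rw [this]
    exact (isIntegral_algebraMap (R := ℤ) (A := K) (x := -10)).map
      (IsScalarTower.toAlgHom ℤ K (AdjoinSqrtNegTen K)) |> fun h => by simpa using h
  let p : 𝓞 K := ⟨_, hcoord_one⟩
  let q : 𝓞 K := ⟨_, hint2⟩
  have hp : algebraMap (𝓞 K) K p = 2 * (η : AdjoinSqrtNegTen K).re := rfl
  have hq : algebraMap (𝓞 K) K q = 20 * (η : AdjoinSqrtNegTen K).im := rfl
  have hre : V.re = algebraMap (𝓞 K) K (1 + 13 * (10 * p)) := by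
    simp only [hVη, QuadraticAlgebra.re_add, QuadraticAlgebra.re_mul,
      QuadraticAlgebra.algebraMap_re, QuadraticAlgebra.algebraMap_im]
    simp only [map_add, map_mul, map_one, map_ofNat, hp]
    ring
  have him : V.im = algebraMap (𝓞 K) K (13 * q) := by
    simp only [hVη, QuadraticAlgebra.im_add, QuadraticAlgebra.im_mul,
      QuadraticAlgebra.algebraMap_re, QuadraticAlgebra.algebraMap_im]
    simp only [map_mul, map_ofNat, hq]
    ring
  have hpell : (1 + 13 * (10 * p)) ^ 2 + 10 * (13 * q) ^ 2 = 1 := by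
    apply RingOfIntegers.coe_injective
    rw [hre, him] at hV1
    simpa only [map_add, map_mul, map_pow, map_one, map_ofNat] using hV1
  refine ⟨_, _, 10 * p, q, hpell, fun hq => ?_, rfl, rfl⟩
  refine htors (e * 2) (by positivity) ?_
  rw [hq, map_zero] at him
  rw [him] at hV1
  have hV2 : V ^ 2 = algebraMap K (AdjoinSqrtNegTen K) 1 := by
    rw [pow_two]
    refine QuadraticAlgebra.ext ?_ ?_
    · simp only [QuadraticAlgebra.re_mul, QuadraticAlgebra.algebraMap_re, him]
      linear_combination hV1
    · simp only [QuadraticAlgebra.im_mul, QuadraticAlgebra.algebraMap_im, him]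
      ring
  refine Units.ext (RingOfIntegers.ext ?_)
  rw [pow_mul, Units.val_pow_eq_pow_val, Units.val_one, RingOfIntegers.coe_eq_algebraMap, map_pow,
    ← RingOfIntegers.coe_eq_algebraMap, ← hV, hV2, map_one]
  rfl

instance fact_prime_thirteen : Fact (Nat.Prime 13) := ⟨by norm_num⟩

theorem norm_add_eq_one {x y : ℚ_[13]} (hx : ‖x‖ = 1) (hy : ‖y‖ < 1) : ‖x + y‖ = 1 := by
  rw [IsUltrametricDist.norm_add_eq_max_of_norm_ne_norm (by rw [hx]; exact hy.ne'), hx,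
    max_eq_left hy.le]

theorem norm_intCast_eq_one {n : ℤ} (h : ¬ (13 : ℤ) ∣ n) : ‖(n : ℚ_[13])‖ = 1 := by
  refine (Padic.norm_int_le_one n).antisymm (not_lt.1 fun hlt => h ?_)
  have := (PadicInt.norm_int_lt_one_iff_dvd (p := 13) n).1 (by
    rw [PadicInt.norm_def, PadicInt.coe_intCast]; exact hlt)
  exact_mod_cast this

theorem norm_thirteen : ‖(13 : ℚ_[13])‖ = 13⁻¹ := by
  simpa using Padic.norm_p (p := 13)

theorem exists_sq_eq_neg_one :
    ∃ α : ℚ_[13], α ^ 2 = -1 ∧ ‖α - 5‖ < 1 := by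
  have h10 : ‖(10 : ℤ_[13])‖ = 1 := by
    have := norm_intCast_eq_one (n := 10) (by norm_num)
    rw [PadicInt.norm_def]
    exact_mod_cast this
  obtain ⟨z, hz, hz5, -⟩ := hensels_lemma (p := 13) (R := ℤ_[13])
    (F := (Polynomial.X ^ 2 + 1 : Polynomial ℤ_[13])) (a := 5) (by
      have h1 : ‖(26 : ℤ_[13])‖ < 1 := by
        have := (PadicInt.norm_int_lt_one_iff_dvd (p := 13) 26).2 (by norm_num)
        exact_mod_cast this
      norm_num [h1, h10])
  refine ⟨z, ?_, ?_⟩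
  · simp only [map_add, map_pow, Polynomial.aeval_X, map_one] at hz
    have := congrArg (fun t : ℤ_[13] => (t : ℚ_[13])) hz
    push_cast at this
    linear_combination this
  · norm_num [h10] at hz5
    exact_mod_cast hz5

section Constants

variable {α : ℚ_[13]}

theorem norm_intCast_mul_lt_one {x : ℚ_[13]} (hx : ‖x‖ < 1) (n : ℤ) : ‖(n : ℚ_[13]) * x‖ < 1 := by
  rw [norm_mul]
  exact (mul_le_of_le_one_left (norm_nonneg _) (Padic.norm_int_le_one n)).trans_lt hx

theorem norm_intCast_add_mul_eq_one (hα5 : ‖α - 5‖ < 1) {m n : ℤ} (h : ¬ (13 : ℤ) ∣ m + n * 5) :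
    ‖(m : ℚ_[13]) + n * α‖ = 1 := by
  have := norm_add_eq_one (norm_intCast_eq_one h) (norm_intCast_mul_lt_one hα5 n)
  rw [← this]
  congr 1
  push_cast
  ring

theorem norm_kappa (hα5 : ‖α - 5‖ < 1) : ‖(5 - 12 * α) / 13‖ = 13 := by
  have := norm_intCast_add_mul_eq_one hα5 (m := 5) (n := -12) (by norm_num)
  push_cast at this
  rw [norm_div, norm_thirteen, show 5 - 12 * α = 5 + -12 * α by ring, this]
  norm_num

theorem norm_lower_left (hα : α ^ 2 = -1) (hα5 : ‖α - 5‖ < 1) :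
    ‖-5 * (53 - 8 * α) / 169‖ = 1 := by
  have h1 := norm_intCast_add_mul_eq_one hα5 (m := 53) (n := 8) (by norm_num)
  have h2 := norm_intCast_eq_one (n := -85) (by norm_num)
  push_cast at h1 h2
  have h3 : -5 * (53 - 8 * α) / 169 * (53 + 8 * α) = -85 := by
    linear_combination (5 * 64 / 169 : ℚ_[13]) * hα
  rw [← h2, ← h3, norm_mul, h1, mul_one]

end Constants

section Quaternions

variable {K A : Type*} [Field K] [CommRing A]

/-- The image of `a + bi + cj + dk` under the splitting, attached to a square root `s` of `-1`,
of the quaternion algebra with `i² = -1` and `j² = -10`. -/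
def quatMatrix (s a b c d : A) : Matrix (Fin 2) (Fin 2) A :=
  !![a + s * b, c + s * d; -10 * (c - s * d), a - s * b]

theorem quatMatrix_mul {s : A} (hs : s ^ 2 = -1) (a b c d a' b' c' d' : A) :
    quatMatrix s a b c d * quatMatrix s a' b' c' d' =
      quatMatrix s (a * a' - b * b' - 10 * c * c' - 10 * d * d')
        (a * b' + b * a' + 10 * c * d' - 10 * d * c')
        (a * c' + c * a' + d * b' - b * d')
        (a * d' + d * a' + b * c' - c * b') := by
  rw [quatMatrix, quatMatrix, Matrix.mul_fin_two, quatMatrix]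
  congrm !![?_, ?_; ?_, ?_]
  · linear_combination (b * b' + 10 * d * d') * hs
  · linear_combination (b * d' - d * b') * hs
  · linear_combination (10 * d * b' - 10 * b * d') * hs
  · linear_combination (b * b' + 10 * d * d') * hs

theorem adjugate_quatMatrix (s a b c d : A) :
    (quatMatrix s a b c d).adjugate = quatMatrix s a (-b) (-c) (-d) := by
  rw [quatMatrix, Matrix.adjugate_fin_two_of, quatMatrix]
  congrm !![?_, ?_; ?_, ?_] <;> ring

theorem quatMatrix_one (s : A) : quatMatrix s 1 0 0 0 = 1 := by
  rw [quatMatrix, Matrix.one_fin_two]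
  congrm !![?_, ?_; ?_, ?_] <;> ring

theorem quat_mul_coords_mem {R : Subring K} {a b c d a' b' c' d' : K} (ha : a ∈ R) (hb : b ∈ R)
    (hc : c ∈ R) (hd : d ∈ R) (ha' : a' ∈ R) (hb' : b' ∈ R) (hc' : c' ∈ R) (hd' : d' ∈ R) :
    a * a' - b * b' - 10 * c * c' - 10 * d * d' ∈ R ∧
      a * b' + b * a' + 10 * c * d' - 10 * d * c' ∈ R ∧
      a * c' + c * a' + d * b' - b * d' ∈ R ∧ a * d' + d * a' + b * c' - c * b' ∈ R := by
  have h10 : (10 : K) ∈ R := ofNat_mem R 10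
  refine ⟨?_, ?_, ?_, ?_⟩
  · exact R.sub_mem (R.sub_mem (R.sub_mem (R.mul_mem ha ha') (R.mul_mem hb hb')) (R.mul_mem
      (R.mul_mem h10 hc) hc')) (R.mul_mem (R.mul_mem h10 hd) hd')
  · exact R.sub_mem (R.add_mem (R.add_mem (R.mul_mem ha hb') (R.mul_mem hb ha')) (R.mul_mem
      (R.mul_mem h10 hc) hd')) (R.mul_mem (R.mul_mem h10 hd) hc')
  · exact R.sub_mem (R.add_mem (R.add_mem (R.mul_mem ha hc') (R.mul_mem hc ha')) (R.mul_mem hd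
      hb')) (R.mul_mem hb hd')
  · exact R.sub_mem (R.add_mem (R.add_mem (R.mul_mem ha hd') (R.mul_mem hd ha')) (R.mul_mem hb
      hc')) (R.mul_mem hc hb')

/-- The image in `M₂(A)` of the group of norm one quaternions with coordinates in `R`. -/
def quatGroup {s : A} (hs : s ^ 2 = -1) (ι : K →+* A) (R : Subring K) :
    Submonoid (Matrix (Fin 2) (Fin 2) A) where
  carrier := {g | ∃ a ∈ R, ∃ b ∈ R, ∃ c ∈ R, ∃ d ∈ R,
    a ^ 2 + b ^ 2 + 10 * c ^ 2 + 10 * d ^ 2 = 1 ∧ g = quatMatrix s (ι a) (ι b) (ι c) (ι d)}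
  one_mem' := ⟨1, R.one_mem, 0, R.zero_mem, 0, R.zero_mem, 0, R.zero_mem, by ring, by
    rw [map_one, map_zero, quatMatrix_one]⟩
  mul_mem' := by
    rintro _ _ ⟨a, ha, b, hb, c, hc, d, hd, h, rfl⟩ ⟨a', ha', b', hb', c', hc', d', hd', h', rfl⟩
    obtain ⟨h₀, h₁, h₂, h₃⟩ := quat_mul_coords_mem ha hb hc hd ha' hb' hc' hd'
    refine ⟨_, h₀, _, h₁, _, h₂, _, h₃, ?_, ?_⟩
    · linear_combination (a' ^ 2 + b' ^ 2 + 10 * c' ^ 2 + 10 * d' ^ 2) * h + h'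
    · rw [quatMatrix_mul hs]
      simp only [map_add, map_sub, map_mul, map_ofNat]

theorem adjugate_mem_quatGroup {s : A} {hs : s ^ 2 = -1} {ι : K →+* A} {R : Subring K}
    {g : Matrix (Fin 2) (Fin 2) A} (hg : g ∈ quatGroup hs ι R) : g.adjugate ∈ quatGroup hs ι R := by
  obtain ⟨a, ha, b, hb, c, hc, d, hd, h, rfl⟩ := hg
  refine ⟨a, ha, -b, R.neg_mem hb, -c, R.neg_mem hc, -d, R.neg_mem hd, by linear_combination h, ?_⟩
  rw [adjugate_quatMatrix, map_neg, map_neg, map_neg]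

end Quaternions

section Unipotent

variable {A : Type*} [CommRing A]

/-- The unipotent matrix with upper right entry `x`. -/
def unipotent (x : A) : Matrix (Fin 2) (Fin 2) A := !![1, x; 0, 1]

theorem unipotent_zero : unipotent (0 : A) = 1 :=
  Matrix.one_fin_two.symm

theorem unipotent_mul (x y : A) : unipotent x * unipotent y = unipotent (x + y) := by
  rw [unipotent, unipotent, unipotent, Matrix.mul_fin_two]
  congrm !![?_, ?_; ?_, ?_] <;> ring

theorem adjugate_unipotent (x : A) : (unipotent x).adjugate = unipotent (-x) := by
  rw [unipotent, Matrix.adjugate_fin_two_of, neg_zero, unipotent]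

theorem conj_unipotent {p q r t : A} (h : p * t - q * r = 1) (y : A) :
    !![p, q; r, t] * unipotent y * !![p, q; r, t].adjugate =
      !![1 - y * (p * r), y * p ^ 2; -(y * r ^ 2), 1 + y * (p * r)] := by
  rw [Matrix.adjugate_fin_two_of, unipotent, Matrix.mul_fin_two, Matrix.mul_fin_two]
  congrm !![?_, ?_; ?_, ?_]
  · linear_combination h
  · ring
  · ring
  · linear_combination h

theorem continuous_unipotent [TopologicalSpace A] : Continuous (unipotent : A → Matrix (Fin 2) (Fin 2) A) := by
  refine continuous_matrix fun i j => ?_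
  fin_cases i <;> fin_cases j <;> simp [unipotent] <;> fun_prop

variable [Algebra ℚ_[13] A]

/-- The diagonal matrix with entries `u` and `u⁻¹`. -/
noncomputable def diagMatrix (A : Type*) [CommRing A] [Algebra ℚ_[13] A] (u : ℚ_[13]) :
    Matrix (Fin 2) (Fin 2) A :=
  !![algebraMap ℚ_[13] A u, 0; 0, algebraMap ℚ_[13] A u⁻¹]

theorem diagMatrix_pow (u : ℚ_[13]) (k : ℕ) : diagMatrix A u ^ k = diagMatrix A (u ^ k) := by
  induction k with
  | zero => simp [diagMatrix, Matrix.one_fin_two]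
  | succ k ih =>
    rw [pow_succ, ih, diagMatrix, diagMatrix, diagMatrix, Matrix.mul_fin_two, pow_succ, mul_inv,
      map_mul, map_mul]
    congrm !![?_, ?_; ?_, ?_] <;> ring

theorem adjugate_diagMatrix (u : ℚ_[13]) : (diagMatrix A u).adjugate = diagMatrix A u⁻¹ := by
  rw [diagMatrix, Matrix.adjugate_fin_two_of, neg_zero, diagMatrix, inv_inv]

theorem conj_diagMatrix {u : ℚ_[13]} (hu : u ≠ 0) (p q r t : A) :
    diagMatrix A u * !![p, q; r, t] * diagMatrix A u⁻¹ =
      !![p, (u ^ 2) • q; (u⁻¹ ^ 2) • r, t] := by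
  have h : algebraMap ℚ_[13] A u * algebraMap ℚ_[13] A u⁻¹ = 1 := by
    rw [← map_mul, mul_inv_cancel₀ hu, map_one]
  rw [diagMatrix, diagMatrix, inv_inv, Matrix.mul_fin_two, Matrix.mul_fin_two, Algebra.smul_def,
    Algebra.smul_def, map_pow, map_pow]
  congrm !![?_, ?_; ?_, ?_]
  · linear_combination p * h
  · ring
  · ring
  · linear_combination t * h

variable {H : Submonoid (Matrix (Fin 2) (Fin 2) A)} {κ : ℚ_[13]}

theorem diagMatrix_pow_mem (hκH : diagMatrix A κ ∈ H) (k : ℕ) : diagMatrix A (κ ^ k) ∈ H := by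
  rw [← diagMatrix_pow]
  exact pow_mem hκH k

theorem diagMatrix_inv_mem (hadj : ∀ g ∈ H, g.adjugate ∈ H) {u : ℚ_[13]}
    (hu : diagMatrix A u ∈ H) : diagMatrix A u⁻¹ ∈ H := by
  rw [← adjugate_diagMatrix]
  exact hadj _ hu

theorem unipotent_smul_mem (hadj : ∀ g ∈ H, g.adjugate ∈ H) {u : ℚ_[13]}
    (hu : diagMatrix A u ∈ H) (hu0 : u ≠ 0) {x : A} (hx : unipotent x ∈ H) :
    unipotent ((u ^ 2) • x) ∈ H := by
  have := H.mul_mem (H.mul_mem hu hx) (diagMatrix_inv_mem hadj hu)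
  rwa [unipotent, conj_diagMatrix hu0, smul_zero] at this

theorem tendsto_inv_pow (hκ : ‖κ‖ = 13) :
    Filter.Tendsto (fun k : ℕ => ((κ ^ k)⁻¹) ^ 2) Filter.atTop (nhds 0) := by
  have h : ‖κ⁻¹ ^ 2‖ < 1 := by rw [norm_pow, norm_inv, hκ]; norm_num
  refine (tendsto_pow_atTop_nhds_zero_of_norm_lt_one h).congr fun k => ?_
  rw [← inv_pow, ← pow_mul, ← pow_mul, mul_comm]

variable [TopologicalSpace A] [IsTopologicalRing A] [ContinuousSMul ℚ_[13] A]

/-- The set of `x` with `unipotent x ∈ H`. -/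
noncomputable def unipotentSubmodule (hcl : IsClosed (H : Set (Matrix (Fin 2) (Fin 2) A)))
    (hadj : ∀ g ∈ H, g.adjugate ∈ H) (hκ : ‖κ‖ = 13) (hκH : diagMatrix A κ ∈ H) :
    Submodule ℚ_[13] A where
  carrier := {x | unipotent x ∈ H}
  zero_mem' := by
    rw [Set.mem_ofPred_eq, unipotent_zero]
    exact H.one_mem
  add_mem' {x y} hx hy := by
    have := H.mul_mem hx hy
    rwa [unipotent_mul] at this
  smul_mem' q x hx := by
    have hκ0 : κ ≠ 0 := by
      rintro rfl
      norm_num at hκ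
    have hnat : ∀ n : ℕ, unipotent ((n : ℚ_[13]) • x) ∈ H := by
      intro n
      induction n with
      | zero =>
        rw [Nat.cast_zero, zero_smul, unipotent_zero]
        exact H.one_mem
      | succ n ih =>
        rw [Nat.cast_succ, add_smul, one_smul, ← unipotent_mul]
        exact H.mul_mem ih hx
    have hcoord : ∀ z : ℤ_[13], unipotent ((z : ℚ_[13]) • x) ∈ H := by
      intro z
      have hc : IsClosed {z : ℤ_[13] | unipotent ((z : ℚ_[13]) • x) ∈ H} :=
        hcl.preimage (continuous_unipotent.comp
          ((continuous_subtype_val (p := fun z : ℚ_[13] => ‖z‖ ≤ 1)).smul continuous_const))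
      exact PadicInt.denseRange_natCast.induction_on z hc fun n => by
        simpa using hnat n
    obtain ⟨k, hk⟩ : ∃ k : ℕ, ‖((κ ^ k)⁻¹) ^ 2 * q‖ ≤ 1 := by
      have := ((tendsto_inv_pow hκ).mul_const q).norm
      rw [zero_mul, norm_zero] at this
      exact ((this.eventually (gt_mem_nhds one_pos)).exists).imp fun _ h => h.le
    have := unipotent_smul_mem hadj (diagMatrix_pow_mem hκH k) (pow_ne_zero k hκ0)
      (hcoord ⟨_, hk⟩)
    rwa [smul_smul, ← mul_assoc, ← mul_pow, mul_inv_cancel₀ (pow_ne_zero k hκ0), one_pow,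
      one_mul] at this

/-- Conjugating by `diagMatrix` contracts a conjugate of a unipotent matrix to a unipotent one. -/
theorem unipotent_mul_sq_mem (hcl : IsClosed (H : Set (Matrix (Fin 2) (Fin 2) A)))
    (hadj : ∀ g ∈ H, g.adjugate ∈ H) (hκ : ‖κ‖ = 13) (hκH : diagMatrix A κ ∈ H)
    {p q r t : A} (hM : !![p, q; r, t] ∈ H) (hdet : p * t - q * r = 1) {x : A}
    (hx : unipotent x ∈ H) : unipotent (x * p ^ 2) ∈ H := by
  have hκ0 : κ ≠ 0 := by
    rintro rfl
    norm_num at hκ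
  let F : ℚ_[13] → Matrix (Fin 2) (Fin 2) A := fun e =>
    !![1 - (e • x) * (p * r), x * p ^ 2; e • (-((e • x) * r ^ 2)), 1 + (e • x) * (p * r)]
  have hF : Continuous F := by
    refine continuous_matrix fun i j => ?_
    fin_cases i <;> fin_cases j <;> simp [F] <;> fun_prop
  have hF0 : F 0 = unipotent (x * p ^ 2) := by
    simp [F, unipotent]
  rw [← hF0]
  refine hcl.mem_of_tendsto ((hF.tendsto 0).comp (tendsto_inv_pow hκ))
    (Filter.Eventually.of_forall fun k => ?_)
  have hk := diagMatrix_pow_mem hκH k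
  have hk0 := pow_ne_zero k hκ0
  have hk' := diagMatrix_inv_mem hadj hk
  have h1 := unipotent_smul_mem hadj hk' (inv_ne_zero hk0) hx
  have h2 := H.mul_mem (H.mul_mem hM h1) (hadj _ hM)
  have h3 := H.mul_mem (H.mul_mem hk h2) hk'
  have e : (κ ^ k) ^ 2 • (((κ ^ k)⁻¹ ^ 2 • x) * p ^ 2) = x * p ^ 2 := by
    rw [smul_mul_assoc, smul_smul, ← mul_pow, mul_inv_cancel₀ hk0, one_pow, one_smul]
  rw [conj_unipotent hdet, conj_diagMatrix hk0, e] at h3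
  exact h3

theorem unipotent_mul_mem (hcl : IsClosed (H : Set (Matrix (Fin 2) (Fin 2) A)))
    (hadj : ∀ g ∈ H, g.adjugate ∈ H) (hκ : ‖κ‖ = 13) (hκH : diagMatrix A κ ∈ H)
    {p q r t : ℚ_[13]} (hdet : p * t - q * r = 1) (hpr : p * r ≠ 0)
    (hδ : !![algebraMap ℚ_[13] A p, algebraMap ℚ_[13] A q;
      algebraMap ℚ_[13] A r, algebraMap ℚ_[13] A t] ∈ H)
    {x y : A} (hx : unipotent x ∈ H) (hy : unipotent y ∈ H) : unipotent (x * y) ∈ H := by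
  let U := unipotentSubmodule hcl hadj hκ hκH
  have hdet' : algebraMap ℚ_[13] A p * algebraMap ℚ_[13] A t -
      algebraMap ℚ_[13] A q * algebraMap ℚ_[13] A r = 1 := by
    rw [← map_mul, ← map_mul, ← map_sub, hdet, map_one]
  have key : ∀ x' ∈ U, y * (1 - x' * algebraMap ℚ_[13] A (p * r)) ^ 2 ∈ U := by
    intro x' hx'
    have h := H.mul_mem (H.mul_mem hδ hx') (hadj _ hδ)
    rw [conj_unipotent hdet', ← map_mul] at h
    refine unipotent_mul_sq_mem hcl hadj hκ hκH h ?_ hy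
    rw [map_mul]
    ring
  have h := U.smul_mem (4 * (p * r))⁻¹ (U.sub_mem (key (-x) (U.neg_mem hx)) (key x hx))
  have h4 : (4 : ℚ_[13]) * (p * r) ≠ 0 := mul_ne_zero (by norm_num) hpr
  have e : (4 * (p * r))⁻¹ • (y * (1 - -x * algebraMap ℚ_[13] A (p * r)) ^ 2 -
      y * (1 - x * algebraMap ℚ_[13] A (p * r)) ^ 2) = x * y := by
    rw [inv_smul_eq_iff₀ h4, Algebra.smul_def, map_mul _ (4 : ℚ_[13]), map_ofNat]
    ring
  rw [e] at h
  exact h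

theorem unipotent_algebraMap_mem [Module.Finite ℚ_[13] A]
    (hcl : IsClosed (H : Set (Matrix (Fin 2) (Fin 2) A)))
    (hadj : ∀ g ∈ H, g.adjugate ∈ H) (hκ : ‖κ‖ = 13) (hκH : diagMatrix A κ ∈ H)
    {p q r t : ℚ_[13]} (hdet : p * t - q * r = 1) (hpr : p * r ≠ 0)
    (hδ : !![algebraMap ℚ_[13] A p, algebraMap ℚ_[13] A q;
      algebraMap ℚ_[13] A r, algebraMap ℚ_[13] A t] ∈ H)
    {l : A} (hl : unipotent l ∈ H) (hreg : ∀ x, l * x = 0 → x = 0) (a : ℚ_[13]) :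
    unipotent (algebraMap ℚ_[13] A a) ∈ H := by
  let U := unipotentSubmodule hcl hadj hκ hκH
  let f : U →ₗ[ℚ_[13]] U := (LinearMap.mulLeft ℚ_[13] l).restrict fun x hx =>
    unipotent_mul_mem hcl hadj hκ hκH hdet hpr hδ hl hx
  have hf : Function.Injective f := (injective_iff_map_eq_zero f).2 fun x hx =>
    Subtype.ext (hreg _ (congrArg Subtype.val hx))
  obtain ⟨⟨x, hxU⟩, hx⟩ := LinearMap.surjective_of_injective hf ⟨l, hl⟩
  have hx1 : x - 1 = 0 := hreg _ (by
    rw [mul_sub, mul_one, sub_eq_zero]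
    exact congrArg Subtype.val hx)
  rw [sub_eq_zero] at hx1
  rw [hx1] at hxU
  have := U.smul_mem a hxU
  rwa [← Algebra.algebraMap_eq_smul_one] at this

end Unipotent

section Pell

variable {R : Type*} [CommRing R]

/-- The matrix of multiplication by `X + Y √-10`. -/
def pellMatrix (X Y : R) : Matrix (Fin 2) (Fin 2) R := !![X, Y; -10 * Y, X]

theorem pellMatrix_mul (X Y X' Y' : R) : pellMatrix X Y * pellMatrix X' Y' =
    pellMatrix (X * X' - 10 * Y * Y') (X * Y' + Y * X') := by
  rw [pellMatrix, pellMatrix, Matrix.mul_fin_two, pellMatrix]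
  congrm !![?_, ?_; ?_, ?_] <;> ring

theorem det_pellMatrix (X Y : R) : (pellMatrix X Y).det = X ^ 2 + 10 * Y ^ 2 := by
  rw [pellMatrix, Matrix.det_fin_two_of]
  ring

theorem mapMatrix_pellMatrix {S : Type*} [CommRing S] (f : R →+* S) (X Y : R) :
    f.mapMatrix (pellMatrix X Y) = pellMatrix (f X) (f Y) := by
  ext i j
  fin_cases i <;> fin_cases j <;> simp [pellMatrix, map_ofNat]

theorem exists_pellMatrix_pow {h Y : R} (hXY : (1 + h) ^ 2 + 10 * Y ^ 2 = 1) (k : ℕ) :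
    ∃ a b : R, pellMatrix (1 + h) Y ^ k = pellMatrix (1 + k ^ 2 * h + h ^ 2 * a)
      (Y * (k + (∑ i ∈ Finset.range k, (i + i ^ 2) : ℕ) * h + h ^ 2 * b)) := by
  induction k with
  | zero =>
    refine ⟨0, 0, ?_⟩
    simp [pellMatrix, Matrix.one_fin_two]
  | succ k ih =>
    obtain ⟨a, b, hab⟩ := ih
    rw [Finset.sum_range_succ]
    set S := ∑ i ∈ Finset.range k, (i + i ^ 2)
    refine ⟨k ^ 2 + a + h * a + 2 * S + 2 * h * b + k + S * h + h ^ 2 * b, b + S + h * b + a, ?_⟩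
    rw [pow_succ, hab, pellMatrix_mul]
    congr 1
    · push_cast
      linear_combination -(k + S * h + h ^ 2 * b) * hXY
    · push_cast
      ring

theorem exists_pellMatrix_pow_thirteen_pow {a Y : R} (hXY : (1 + 13 * a) ^ 2 + 10 * Y ^ 2 = 1)
    (n : ℕ) : ∃ a' u : R, pellMatrix (1 + 13 * a) Y ^ 13 ^ n =
      pellMatrix (1 + 13 ^ (n + 1) * a') (13 ^ n * Y * (1 + 13 * u)) := by
  induction n with
  | zero => exact ⟨a, 0, by simp⟩
  | succ n ih =>
    obtain ⟨c, u, hcu⟩ := ih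
    have hdet := congrArg Matrix.det hcu
    rw [Matrix.det_pow, det_pellMatrix, hXY, one_pow, det_pellMatrix] at hdet
    obtain ⟨p, q, hpq⟩ := exists_pellMatrix_pow hdet.symm 13
    rw [pow_succ, pow_mul, hcu, hpq]
    have hS : ∑ i ∈ Finset.range 13, (i + i ^ 2) = 728 := rfl
    rw [hS]
    refine ⟨13 * c + 13 ^ n * c ^ 2 * p, u + (56 * 13 ^ n * c + 13 ^ (2 * n) * c ^ 2 * q) +
      13 * u * (56 * 13 ^ n * c + 13 ^ (2 * n) * c ^ 2 * q), ?_⟩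
    congr 1
    · push_cast
      ring
    · push_cast
      ring

end Pell

section Limit

variable {A : Type*} [CommRing A] [TopologicalSpace A] [IsTopologicalRing A] [T2Space A]
  [Algebra ℚ_[13] A] [ContinuousSMul ℚ_[13] A]

theorem exists_tendsto_hyperfilter {X : Type*} [TopologicalSpace X] {s : Set X} (hs : IsCompact s)
    {f : ℕ → X} (hf : ∀ n, f n ∈ s) :
    ∃ x ∈ s, Filter.Tendsto f (Filter.hyperfilter ℕ : Filter ℕ) (nhds x) :=
  hs.ultrafilter_le_nhds' ((Filter.hyperfilter ℕ).map f) (Filter.eventually_map.2 (Filter.Eventually.of_forall hf))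

theorem tendsto_thirteen_pow :
    Filter.Tendsto (fun n : ℕ => (13 : ℚ_[13]) ^ n) (Filter.hyperfilter ℕ : Filter ℕ) (nhds 0) :=
  (tendsto_pow_atTop_nhds_zero_of_norm_lt_one (by rw [norm_thirteen]; norm_num)).mono_left
    Nat.hyperfilter_le_atTop

theorem eq_zero_of_one_add_mul_eq_zero {A₀ : Subring A} (hA₀ : IsCompact (A₀ : Set A)) {u x : A}
    (hu : u ∈ A₀) (h : (1 + 13 * u) * x = 0) : x = 0 := by
  obtain ⟨v, -, hv⟩ := exists_tendsto_hyperfilter hA₀ fun n : ℕ => pow_mem (neg_mem hu) n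
  have hx : ∀ n : ℕ, (13 : ℚ_[13]) ^ n • ((-u) ^ n * x) = x := by
    intro n
    induction n with
    | zero => simp
    | succ n ih =>
      rw [Algebra.smul_def, map_pow, map_ofNat] at ih ⊢
      linear_combination ih - 13 ^ n * (-u) ^ n * h
  have := tendsto_thirteen_pow.smul (hv.mul_const x)
  rw [zero_smul] at this
  exact tendsto_nhds_unique (tendsto_const_nhds.congr fun n => (hx n).symm) this

theorem exists_regular_unipotent_mem {H : Submonoid (Matrix (Fin 2) (Fin 2) A)} {κ : ℚ_[13]}
    (hcl : IsClosed (H : Set (Matrix (Fin 2) (Fin 2) A))) (hadj : ∀ g ∈ H, g.adjugate ∈ H)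
    (hκ : ‖κ‖ = 13) (hκH : diagMatrix A κ ∈ H) {A₀ : Subring A} (hA₀ : IsCompact (A₀ : Set A))
    {y : A} (hy : IsUnit y) (hM : ∀ n : ℕ, ∃ a ∈ A₀, ∃ u ∈ A₀,
      pellMatrix (1 + 13 ^ (n + 1) * a) (13 ^ n * y * (1 + 13 * u)) ∈ H) :
    ∃ l, unipotent l ∈ H ∧ ∀ x, l * x = 0 → x = 0 := by
  have hκ0 : κ ≠ 0 := by
    rintro rfl
    norm_num at hκ
  choose a ha u hu hM using hM
  obtain ⟨a', -, ha'⟩ := exists_tendsto_hyperfilter hA₀ fun m => ha (2 * m)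
  obtain ⟨u', hu'A, hu'⟩ := exists_tendsto_hyperfilter hA₀ fun m => hu (2 * m)
  have hc : ∀ m : ℕ, (κ ^ m) ^ 2 * 13 ^ (2 * m) ∈ Metric.sphere (0 : ℚ_[13]) 1 := by
    intro m
    rw [mem_sphere_zero_iff_norm, norm_mul, norm_pow, norm_pow, norm_pow, hκ, norm_thirteen,
      ← pow_mul, mul_comm m, ← mul_pow]
    norm_num
  obtain ⟨c, hc1, hc'⟩ := exists_tendsto_hyperfilter (isCompact_sphere 0 1) hc
  have hc0 : c ≠ 0 := by
    rintro rfl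
    simp at hc1
  have h13 : Filter.Tendsto (fun m : ℕ => (13 : ℚ_[13]) ^ (2 * m + 1))
      (Filter.hyperfilter ℕ : Filter ℕ) (nhds 0) := by
    have := ((tendsto_thirteen_pow.pow 2).mul_const 13)
    rw [zero_pow two_ne_zero, zero_mul] at this
    exact this.congr fun m => by ring
  have hκ13 : Filter.Tendsto (fun m : ℕ => ((κ ^ m)⁻¹) ^ 2 * 13 ^ (2 * m))
      (Filter.hyperfilter ℕ : Filter ℕ) (nhds 0) := by
    have := ((tendsto_inv_pow hκ).mono_left Nat.hyperfilter_le_atTop).mul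
      (tendsto_thirteen_pow.pow 2)
    rw [zero_mul] at this
    exact this.congr fun m => by ring
  let F : ℚ_[13] × ℚ_[13] × ℚ_[13] × A × A → Matrix (Fin 2) (Fin 2) A := fun v =>
    !![1 + v.1 • v.2.2.2.1, v.2.2.1 • (y * (1 + 13 * v.2.2.2.2));
      v.2.1 • (-10 * (y * (1 + 13 * v.2.2.2.2))), 1 + v.1 • v.2.2.2.1]
  have hF : Continuous F := by
    refine continuous_matrix fun i j => ?_
    fin_cases i <;> fin_cases j <;> simp [F] <;> fun_prop
  have hlim := (hF.tendsto _).comp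
    (h13.prodMk_nhds (hκ13.prodMk_nhds (hc'.prodMk_nhds (ha'.prodMk_nhds hu'))))
  have hF0 : F (0, 0, c, a', u') = unipotent (c • (y * (1 + 13 * u'))) := by
    simp [F, unipotent]
  rw [hF0] at hlim
  refine ⟨_, hcl.mem_of_tendsto hlim (Filter.Eventually.of_forall fun m => ?_), fun x hx => ?_⟩
  · have hk := diagMatrix_pow_mem hκH m
    have h := H.mul_mem (H.mul_mem hk (hM (2 * m))) (diagMatrix_inv_mem hadj hk)
    rw [pellMatrix, conj_diagMatrix (pow_ne_zero m hκ0)] at h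
    refine Set.mem_of_eq_of_mem ?_ h
    simp only [Function.comp_apply, F]
    congrm !![?_, ?_; ?_, ?_] <;> simp only [Algebra.smul_def, map_mul, map_pow, map_ofNat] <;> ring
  · rw [smul_mul_assoc, smul_eq_zero_iff_right hc0, mul_assoc, hy.mul_right_eq_zero] at hx
    exact eq_zero_of_one_add_mul_eq_zero hA₀ hu'A hx

end Limit

section Approximation

variable {K A : Type*} [Field K] [CommRing A]

/-- The elements of `K` which become algebraic integers after multiplication by a power of `13`. -/
def integralAwayThirteen (K : Type*) [Field K] : Subring K where
  carrier := {r | ∃ n : ℕ, IsIntegral ℤ (13 ^ n * r)}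
  mul_mem' := by
    rintro r t ⟨m, hm⟩ ⟨n, hn⟩
    exact ⟨m + n, by rw [pow_add, mul_mul_mul_comm]; exact hm.mul hn⟩
  one_mem' := ⟨0, by simpa using isIntegral_one⟩
  add_mem' := by
    rintro r t ⟨m, hm⟩ ⟨n, hn⟩
    have h13 : IsIntegral ℤ (13 : K) := mod_cast isIntegral_intCast (R := ℤ) 13
    refine ⟨m + n, ?_⟩
    rw [show (13 : K) ^ (m + n) * (r + t) = 13 ^ n * (13 ^ m * r) + 13 ^ m * (13 ^ n * t) by ring]
    exact ((h13.pow n).mul hm).add ((h13.pow m).mul hn)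
  zero_mem' := ⟨0, by simpa using isIntegral_zero⟩
  neg_mem' := by
    rintro r ⟨n, hn⟩
    exact ⟨n, by rw [mul_neg]; exact hn.neg⟩

theorem mem_integralAwayThirteen_of_isIntegral {r : K} (hr : IsIntegral ℤ r) :
    r ∈ integralAwayThirteen K :=
  ⟨0, by simpa using hr⟩

theorem intCast_div_thirteen_mem [CharZero K] (m : ℤ) :
    (m : K) / 13 ∈ integralAwayThirteen K := by
  refine ⟨1, ?_⟩
  rw [pow_one, mul_div_cancel₀ _ (by norm_num)]
  exact isIntegral_intCast m

theorem map_ratCast_eq [CharZero K] [Algebra ℚ_[13] A] (ι : K →+* A) (q : ℚ) :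
    ι q = algebraMap ℚ_[13] A q :=
  RingHom.congr_fun (Subsingleton.elim (ι.comp (algebraMap ℚ K))
    ((algebraMap ℚ_[13] A).comp (algebraMap ℚ ℚ_[13]))) q

theorem exists_conj_quatMatrix_eq {R : Subring K} {a b c d x y z : K} (ha : a ∈ R) (hb : b ∈ R)
    (hc : c ∈ R) (hd : d ∈ R) (hx : x ∈ R) (hy : 2 * y ∈ R) (hz : 2 * z ∈ R)
    (h : a ^ 2 + b ^ 2 + 10 * c ^ 2 + 10 * d ^ 2 = 1) :
    ∃ x' y' z' : K, x' ∈ R ∧ 2 * y' ∈ R ∧ 2 * z' ∈ R ∧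
      x' ^ 2 + 10 * y' ^ 2 + 10 * z' ^ 2 = x ^ 2 + 10 * y ^ 2 + 10 * z ^ 2 ∧
      ∀ {A : Type*} [CommRing A] {s : A}, s ^ 2 = -1 → ∀ ι : K →+* A,
        quatMatrix s (ι a) (ι b) (ι c) (ι d) * quatMatrix s 0 (ι x) (ι y) (ι z) *
            (quatMatrix s (ι a) (ι b) (ι c) (ι d)).adjugate =
          quatMatrix s 0 (ι x') (ι y') (ι z') := by
  have h2 : (2 : K) ∈ R := ofNat_mem R 2
  have h10 : (10 : K) ∈ R := ofNat_mem R 10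
  obtain ⟨h₀, h₁, h₂, h₃⟩ := quat_mul_coords_mem ha hb hc hd R.zero_mem (mul_mem h2 hx) hy hz
  obtain ⟨-, -, h₂', h₃'⟩ := quat_mul_coords_mem h₀ h₁ h₂ h₃ ha (neg_mem hb) (neg_mem hc)
    (neg_mem hd)
  have h₁' : (a * a + b * b - 10 * (c * c) - 10 * (d * d)) * x +
      10 * (b * c - a * d) * (2 * y) + 10 * (b * d + a * c) * (2 * z) ∈ R := by
    clear h₀ h₁ h₂ h₃ h₂' h₃' h
    aesop
  refine ⟨_, (a * 0 - b * x - 10 * c * y - 10 * d * z) * -c +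
    (a * y + c * 0 + d * x - b * z) * a + (a * z + d * 0 + b * y - c * x) * -b -
    (a * x + b * 0 + 10 * c * z - 10 * d * y) * -d,
    (a * 0 - b * x - 10 * c * y - 10 * d * z) * -d +
    (a * z + d * 0 + b * y - c * x) * a + (a * x + b * 0 + 10 * c * z - 10 * d * y) * -c -
    (a * y + c * 0 + d * x - b * z) * -b, h₁', ?_, ?_, ?_, fun hs ι => ?_⟩
  · convert h₂' using 1
    ring
  · convert h₃' using 1
    ring
  · linear_combination (x ^ 2 + 10 * y ^ 2 + 10 * z ^ 2) *
      (a ^ 2 + b ^ 2 + 10 * c ^ 2 + 10 * d ^ 2 + 1) * h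
  · rw [adjugate_quatMatrix, quatMatrix_mul hs, quatMatrix_mul hs]
    simp only [map_add, map_sub, map_mul, map_neg, map_ofNat, map_zero]
    congr 1 <;> ring

end Approximation

section StrongApproximation

variable {K A : Type*} [Field K] [CommRing A]

theorem adjugate_mem_topologicalClosure [TopologicalSpace A] [IsTopologicalRing A]
    {s : A} {hs : s ^ 2 = -1} {ι : K →+* A} {R : Subring K}
    {g : Matrix (Fin 2) (Fin 2) A} (hg : g ∈ (quatGroup hs ι R).topologicalClosure) :
    g.adjugate ∈ (quatGroup hs ι R).topologicalClosure :=
  map_mem_closure continuous_id.matrix_adjugate hg fun _ => adjugate_mem_quatGroup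

variable [CharZero K] [Algebra ℚ_[13] A]

theorem algebraMap_sq_eq_neg_one {α : ℚ_[13]} (hα : α ^ 2 = -1) :
    algebraMap ℚ_[13] A α ^ 2 = -1 := by
  rw [← map_pow, hα, map_neg, map_one]

theorem diagMatrix_mem_quatGroup {α : ℚ_[13]} (hα : α ^ 2 = -1) (ι : K →+* A) :
    diagMatrix A ((5 - 12 * α) / 13) ∈
      quatGroup (algebraMap_sq_eq_neg_one hα) ι (integralAwayThirteen K) := by
  have h5 := intCast_div_thirteen_mem (K := K) 5
  have h12 := intCast_div_thirteen_mem (K := K) (-12)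
  push_cast at h5 h12
  refine ⟨_, h5, _, h12, 0, zero_mem _, 0, zero_mem _, by norm_num, ?_⟩
  have e5 := map_ratCast_eq ι (5 / 13)
  have e12 := map_ratCast_eq ι (-12 / 13)
  push_cast at e5 e12
  have hinv : ((5 - 12 * α) / 13)⁻¹ = (5 + 12 * α) / 13 :=
    inv_eq_of_mul_eq_one_right (by linear_combination (-144 / 169 : ℚ_[13]) * hα)
  rw [diagMatrix, hinv, quatMatrix, e5, e12, map_zero]
  simp only [← map_mul, ← map_add, ← map_sub, mul_zero, add_zero, sub_zero]
  congrm !![algebraMap _ _ ?_, 0; 0, algebraMap _ _ ?_] <;> ring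

theorem exists_mem_quatGroup_lower_left_ne_zero {s : A} (hs : s ^ 2 = -1) (ι : K →+* A) :
    !![algebraMap ℚ_[13] A (3 / 13), algebraMap ℚ_[13] A (4 / 13);
      algebraMap ℚ_[13] A (-40 / 13), algebraMap ℚ_[13] A (3 / 13)] ∈
      quatGroup hs ι (integralAwayThirteen K) := by
  have h3 := intCast_div_thirteen_mem (K := K) 3
  have h4 := intCast_div_thirteen_mem (K := K) 4
  push_cast at h3 h4
  refine ⟨_, h3, 0, zero_mem _, _, h4, 0, zero_mem _, by norm_num, ?_⟩
  have e3 := map_ratCast_eq ι (3 / 13)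
  have e4 := map_ratCast_eq ι (4 / 13)
  push_cast at e3 e4
  rw [quatMatrix, e3, e4, map_zero]
  have e40 : algebraMap ℚ_[13] A (-40 / 13) = -10 * algebraMap ℚ_[13] A (4 / 13) := by
    rw [← map_ofNat (algebraMap ℚ_[13] A) 10, ← map_neg, ← map_mul]
    congr 1
    norm_num
  rw [e40, mul_zero, add_zero, add_zero, sub_zero, sub_zero]

variable [TopologicalSpace A] [IsTopologicalRing A] [T2Space A] [ContinuousSMul ℚ_[13] A] [Module.Finite ℚ_[13] A]

theorem unipotent_algebraMap_mem_topologicalClosure {α : ℚ_[13]} (hα : α ^ 2 = -1)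
    (hα5 : ‖α - 5‖ < 1) (ι : K →+* A) {A₀ : Subring A} (hA₀ : IsCompact (A₀ : Set A))
    (hι : ∀ r : K, IsIntegral ℤ r → ι r ∈ A₀) {X Y a : K} (hXY : X ^ 2 + 10 * Y ^ 2 = 1)
    (hY : Y ≠ 0) (ha : IsIntegral ℤ a) (hYi : IsIntegral ℤ Y) (hX : X = 1 + 13 * a) (t : ℚ_[13]) :
    unipotent (algebraMap ℚ_[13] A t) ∈ (quatGroup (algebraMap_sq_eq_neg_one hα) ι
      (integralAwayThirteen K)).topologicalClosure := by
  set G := quatGroup (algebraMap_sq_eq_neg_one (A := A) hα) ι (integralAwayThirteen K)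
  have hcl := G.isClosed_topologicalClosure
  have hadj : ∀ g ∈ G.topologicalClosure, g.adjugate ∈ G.topologicalClosure :=
    fun g => adjugate_mem_topologicalClosure
  have hκ := norm_kappa hα5
  have hκH := G.le_topologicalClosure (diagMatrix_mem_quatGroup hα ι)
  have hδ := G.le_topologicalClosure
    (exists_mem_quatGroup_lower_left_ne_zero (algebraMap_sq_eq_neg_one hα) ι)
  subst hX
  have hM : pellMatrix (1 + 13 * ι a) (ι Y) ∈ G := by
    have hi13 : IsIntegral ℤ (13 : K) := mod_cast isIntegral_intCast (R := ℤ) 13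
    refine ⟨1 + 13 * a, mem_integralAwayThirteen_of_isIntegral
      (isIntegral_one.add (hi13.mul ha)), 0, zero_mem _, Y,
      mem_integralAwayThirteen_of_isIntegral hYi, 0, zero_mem _, by linear_combination hXY, ?_⟩
    simp [pellMatrix, quatMatrix, map_ofNat]
  obtain ⟨l, hl, hreg⟩ := exists_regular_unipotent_mem hcl hadj hκ hκH hA₀
    (y := ι Y) ((IsUnit.mk0 Y hY).map ι) fun n => by
      obtain ⟨c, u, h⟩ := exists_pellMatrix_pow_thirteen_pow (R := A₀) (a := ⟨ι a, hι a ha⟩)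
        (Y := ⟨ι Y, hι Y hYi⟩) (by
          have := congrArg ι hXY
          simp only [map_add, map_mul, map_pow, map_ofNat, map_one] at this
          refine A₀.subtype_injective ?_
          simpa only [map_add, map_mul, map_pow, map_ofNat, map_one, Subring.subtype_apply]
            using this) n
      refine ⟨c, c.2, u, u.2, G.le_topologicalClosure ?_⟩
      have h' := congrArg A₀.subtype.mapMatrix h
      simp only [mapMatrix_pellMatrix, map_add, map_mul, map_pow, map_ofNat, map_one,
        Subring.subtype_apply] at h'
      rw [← h']
      exact pow_mem hM _
  exact unipotent_algebraMap_mem hcl hadj hκ hκH (by norm_num) (by norm_num) hδ hl hreg t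

theorem exists_sum_eq_fifteen_of_compact_open {α : ℚ_[13]} (hα : α ^ 2 = -1) (hα5 : ‖α - 5‖ < 1)
    (ι : K →+* A) {A₀ : Subring A} (hA₀ : IsCompact (A₀ : Set A)) (hA₀' : IsOpen (A₀ : Set A))
    (hι : ∀ r : K, IsIntegral ℤ r → ι r ∈ A₀)
    (hι' : ∀ (r : K) (n : ℕ), IsIntegral ℤ (13 ^ n * r) → ι r ∈ A₀ → IsIntegral ℤ r)
    (halg : ∀ q : ℚ_[13], ‖q‖ ≤ 1 → algebraMap ℚ_[13] A q ∈ A₀)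
    {X Y a : K} (hXY : X ^ 2 + 10 * Y ^ 2 = 1) (hY : Y ≠ 0) (ha : IsIntegral ℤ a)
    (hYi : IsIntegral ℤ Y) (hX : X = 1 + 13 * a) :
    ∃ x y z : K, IsIntegral ℤ x ∧ IsIntegral ℤ y ∧ IsIntegral ℤ z ∧
      15 = 2 * x ^ 2 + 5 * y ^ 2 + 5 * z ^ 2 := by
  have hs := algebraMap_sq_eq_neg_one (A := A) hα
  set s := algebraMap ℚ_[13] A α
  set c := -5 * (53 - 8 * α) / 169 with hc
  have hcn : ‖c‖ = 1 := norm_lower_left hα hα5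
  have hc0 : c ≠ 0 := by
    rw [← norm_ne_zero_iff, hcn]
    exact one_ne_zero
  have hα1 : ‖α‖ ≤ 1 := by
    have : ‖α‖ ^ 2 = 1 := by rw [← norm_pow, hα, norm_neg, norm_one]
    exact (pow_le_one_iff_of_nonneg (norm_nonneg _) two_ne_zero).1 this.le
  have hsA : s ∈ A₀ := halg α hα1
  have h10 : ‖(1 / 10 : ℚ_[13])‖ ≤ 1 := by
    have := norm_intCast_eq_one (n := 10) (by norm_num)
    push_cast at this
    rw [norm_div, this, norm_one, div_one]
  let V : Matrix (Fin 2) (Fin 2) A := quatMatrix s 0 (ι (35 / 13)) (ι (53 / 338)) (ι (4 / 169))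
  have hV : V = !![algebraMap ℚ_[13] A (α * (35 / 13)), algebraMap ℚ_[13] A ((53 + 8 * α) / 338);
      algebraMap ℚ_[13] A c, algebraMap ℚ_[13] A (-(α * (35 / 13)))] := by
    have e₁ := map_ratCast_eq ι (35 / 13)
    have e₂ := map_ratCast_eq ι (53 / 338)
    have e₃ := map_ratCast_eq ι (4 / 169)
    push_cast at e₁ e₂ e₃
    simp only [V, quatMatrix, e₁, e₂, e₃]
    simp only [← map_mul, ← map_add, ← map_sub, ← map_neg, ← map_ofNat (algebraMap ℚ_[13] A), s,
      zero_add, zero_sub, hc]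
    congrm !![algebraMap _ _ ?_, algebraMap _ _ ?_; algebraMap _ _ ?_, algebraMap _ _ ?_] <;> ring
  set t := -(α * (35 / 13)) / c with ht
  have htc : t * c = -(α * (35 / 13)) := div_mul_cancel₀ _ hc0
  let Φ : Matrix (Fin 2) (Fin 2) A → Matrix (Fin 2) (Fin 2) A := fun g => g * V * g.adjugate
  have hΦ : Continuous Φ :=
    (continuous_id.matrix_mul continuous_const).matrix_mul continuous_id.matrix_adjugate
  let U : Set (Matrix (Fin 2) (Fin 2) A) := {g | ∀ i j, Φ g i j ∈ A₀}
  have hU : IsOpen U := by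
    simp only [U, Set.ofPred_forall]
    exact isOpen_iInter_of_finite fun i => isOpen_iInter_of_finite fun j =>
      hA₀'.preimage (hΦ.matrix_elem i j)
  have htU : unipotent (algebraMap ℚ_[13] A t) ∈ U := by
    have hΦt : Φ (unipotent (algebraMap ℚ_[13] A t)) =
        !![0, algebraMap ℚ_[13] A (-(15 / 2) / c); algebraMap ℚ_[13] A c, 0] := by
      simp only [Φ, hV, adjugate_unipotent]
      rw [unipotent, unipotent, Matrix.mul_fin_two, Matrix.mul_fin_two]
      congrm !![?_, ?_; ?_, ?_]
      all_goals
        simp only [← map_mul, ← map_add, ← map_neg, ← map_zero (algebraMap ℚ_[13] A),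
          ← map_one (algebraMap ℚ_[13] A)]
        congr 1
      · linear_combination htc
      · rw [eq_div_iff hc0]
        linear_combination (-t * c - 2 * (α * (35 / 13)) + (α * (35 / 13))) * htc +
          (53 + 8 * α) / 338 * hc + 207185 / 28561 * hα
      · ring
      · linear_combination -htc
    have h0 := zero_mem A₀
    have h₁ : algebraMap ℚ_[13] A c ∈ A₀ := halg c hcn.le
    have h₂ : algebraMap ℚ_[13] A (-(15 / 2) / c) ∈ A₀ := by
      refine halg _ ?_
      have e₂ := norm_intCast_eq_one (n := 2) (by norm_num)
      have e₁₅ := norm_intCast_eq_one (n := 15) (by norm_num)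
      push_cast at e₂ e₁₅
      rw [norm_div, norm_neg, norm_div, hcn, e₂, e₁₅]
      norm_num
    intro i j
    rw [hΦt]
    fin_cases i <;> fin_cases j
    exacts [h0, h₂, h₁, h0]
  obtain ⟨γ, hγU, b₀, hb₀, b₁, hb₁, b₂, hb₂, b₃, hb₃, hb, rfl⟩ := mem_closure_iff.1
    (unipotent_algebraMap_mem_topologicalClosure hα hα5 ι hA₀ hι hXY hY ha hYi hX t) U hU htU
  have hmem : (35 / 13 : K) ∈ integralAwayThirteen K ∧
      (2 * (53 / 338) : K) ∈ integralAwayThirteen K ∧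
      (2 * (4 / 169) : K) ∈ integralAwayThirteen K := by
    have h₁ := intCast_div_thirteen_mem (K := K) 1
    have h₃₅ := intCast_div_thirteen_mem (K := K) 35
    have h₅₃ := intCast_div_thirteen_mem (K := K) 53
    have h₈ := intCast_div_thirteen_mem (K := K) 8
    push_cast at h₁ h₃₅ h₅₃ h₈
    have h₅₃' := mul_mem h₁ h₅₃
    have h₈' := mul_mem h₁ h₈
    norm_num at h₃₅ h₅₃' h₈' ⊢
    exact ⟨h₃₅, h₅₃', h₈'⟩
  obtain ⟨x, y, z, hx, hy, hz, hxyz, hconj⟩ := exists_conj_quatMatrix_eq hb₀ hb₁ hb₂ hb₃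
    hmem.1 hmem.2.1 hmem.2.2 hb
  replace hγU : ∀ i j, quatMatrix s 0 (ι x) (ι y) (ι z) i j ∈ A₀ := by
    rw [← hconj hs ι]
    exact hγU
  have hcoord : ∀ {r : K}, r ∈ integralAwayThirteen K → ι r ∈ A₀ → IsIntegral ℤ r :=
    fun ⟨n, hn⟩ h => hι' _ n hn h
  have g₀₀ : s * ι x ∈ A₀ := by simpa [quatMatrix] using hγU 0 0
  have g₀₁ : ι y + s * ι z ∈ A₀ := by simpa [quatMatrix] using hγU 0 1
  have g₁₀ : -10 * (ι y - s * ι z) ∈ A₀ := by simpa [quatMatrix] using hγU 1 0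
  have ht10 := halg _ h10
  have hu : algebraMap ℚ_[13] A (1 / 10) * 10 = 1 := by
    rw [← map_ofNat (algebraMap ℚ_[13] A) 10, ← map_mul]
    norm_num
  have g₁₀' := mul_mem ht10 g₁₀
  refine ⟨x, 2 * y, 2 * z, hcoord hx ?_, hcoord hy ?_, hcoord hz ?_, ?_⟩
  · convert neg_mem (mul_mem hsA g₀₀) using 1
    linear_combination ι x * hs
  · convert sub_mem g₀₁ g₁₀' using 1
    rw [map_mul, map_ofNat]
    linear_combination (s * ι z - ι y) * hu
  · convert neg_mem (mul_mem hsA (add_mem g₀₁ g₁₀')) using 1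
    rw [map_mul, map_ofNat]
    linear_combination 2 * ι z * hs + (s ^ 2 * ι z - s * ι y) * hu
  · linear_combination -2 * hxyz

end StrongApproximation

section Lattice

variable {ι A : Type*} [Fintype ι] [CommRing A] [Algebra ℚ_[13] A] (B : Module.Basis ι ℚ_[13] A)

/-- The subring of elements with `13`-adically integral coordinates in a basis whose structure
constants are integral. -/
def latticeSubring (h1 : ∀ k, ‖B.repr 1 k‖ ≤ 1) (hmul : ∀ i j k, ‖B.repr (B i * B j) k‖ ≤ 1) :
    Subring A where
  carrier := {a | ∀ k, ‖B.repr a k‖ ≤ 1}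
  one_mem' := h1
  zero_mem' k := by simp
  neg_mem' {a} ha k := by simpa using ha k
  add_mem' {a b} ha hb k := by
    rw [map_add, Finsupp.add_apply]
    exact (Padic.nonarchimedean _ _).trans (max_le (ha k) (hb k))
  mul_mem' {a b} ha hb k := by
    rw [← B.sum_repr a, ← B.sum_repr b, Finset.sum_mul_sum]
    simp only [map_sum, Finsupp.finsetSum_apply, smul_mul_smul_comm, map_smul, Finsupp.smul_apply]
    refine IsUltrametricDist.norm_sum_le_of_forall_le_of_nonneg zero_le_one fun i _ =>
      IsUltrametricDist.norm_sum_le_of_forall_le_of_nonneg zero_le_one fun j _ => ?_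
    rw [smul_eq_mul, norm_mul, norm_mul]
    exact mul_le_one₀ (mul_le_one₀ (ha i) (norm_nonneg _) (hb j)) (norm_nonneg _) (hmul i j k)

variable [TopologicalSpace A] [IsModuleTopology ℚ_[13] A]

theorem isOpen_latticeSubring {h1 : ∀ k, ‖B.repr 1 k‖ ≤ 1}
    {hmul : ∀ i j k, ‖B.repr (B i * B j) k‖ ≤ 1} :
    IsOpen (latticeSubring B h1 hmul : Set A) := by
  have hB : Continuous B.equivFun := IsModuleTopology.continuous_of_linearMap B.equivFun.toLinearMap
  have : IsOpen (⋂ k, B.equivFun ⁻¹' {v | ‖v k‖ ≤ 1}) :=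
    isOpen_iInter_of_finite fun k => IsOpen.preimage hB <| by
      have := (IsUltrametricDist.isOpen_closedBall (0 : ℚ_[13]) one_ne_zero).preimage
        (continuous_apply (A := fun _ : ι => ℚ_[13]) k)
      simpa [Set.preimage] using this
  convert this using 1
  ext a
  simp [latticeSubring]

theorem isCompact_latticeSubring {h1 : ∀ k, ‖B.repr 1 k‖ ≤ 1}
    {hmul : ∀ i j k, ‖B.repr (B i * B j) k‖ ≤ 1} :
    IsCompact (latticeSubring B h1 hmul : Set A) := by
  have := IsModuleTopology.toContinuousAdd ℚ_[13] A
  have hB : Continuous B.equivFun.symm :=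
    IsModuleTopology.continuous_of_linearMap B.equivFun.symm.toLinearMap
  convert (isCompact_univ_pi fun _ : ι => isCompact_closedBall (0 : ℚ_[13]) 1).image hB using 1
  ext a
  constructor
  · exact fun ha => ⟨B.equivFun a, fun k _ => mem_closedBall_zero_iff.2 (ha k),
      B.equivFun.symm_apply_apply a⟩
  · rintro ⟨v, hv, rfl⟩ k
    rw [← B.equivFun_apply, LinearEquiv.apply_symm_apply]
    exact mem_closedBall_zero_iff.1 (hv k trivial)

end Lattice

section Completion

open scoped TensorProduct

variable (K : Type*) [Field K] [NumberField K]

theorem integralBasis_repr_eq_intCast {r : K} (hr : IsIntegral ℤ r)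
    (i : Module.Free.ChooseBasisIndex ℤ (𝓞 K)) :
    ∃ m : ℤ, (NumberField.integralBasis K).repr r i = m :=
  ⟨_, NumberField.integralBasis_repr_apply K ⟨r, hr⟩ i⟩

theorem isIntegral_of_integralBasis_repr {r : K}
    (hr : ∀ i, ∃ m : ℤ, (NumberField.integralBasis K).repr r i = m) : IsIntegral ℤ r := by
  rw [← (NumberField.integralBasis K).sum_repr r]
  refine IsIntegral.sum _ fun i _ => ?_
  obtain ⟨m, hm⟩ := hr i
  rw [hm, Algebra.smul_def, map_intCast, NumberField.integralBasis_apply]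
  exact (isIntegral_intCast m).mul (RingOfIntegers.isIntegral_coe _)

theorem exists_eq_intCast_of_thirteen_pow_mul {c : ℚ} {n : ℕ} {m : ℤ} (h : 13 ^ n * c = m)
    (hc : ‖(c : ℚ_[13])‖ ≤ 1) : ∃ m' : ℤ, c = m' := by
  have h' : ‖(m : ℚ_[13])‖ ≤ (13 : ℝ) ^ (-n : ℤ) := by
    have := congrArg (fun q : ℚ => ‖(q : ℚ_[13])‖) h
    push_cast at this
    rw [← this, norm_mul, norm_pow, norm_thirteen, zpow_neg, zpow_natCast, inv_pow]
    exact mul_le_of_le_one_right (by positivity) hc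
  obtain ⟨m', hm'⟩ := (Padic.norm_int_le_pow_iff_dvd m n).1 (mod_cast h')
  refine ⟨m', mul_left_cancel₀ (pow_ne_zero n (by norm_num : (13 : ℚ) ≠ 0)) ?_⟩
  rw [h, hm']
  push_cast
  ring

theorem exists_sum_eq_fifteen_of_pell {X Y a : K} (hXY : X ^ 2 + 10 * Y ^ 2 = 1) (hY : Y ≠ 0)
    (ha : IsIntegral ℤ a) (hYi : IsIntegral ℤ Y) (hX : X = 1 + 13 * a) :
    ∃ x y z : K, IsIntegral ℤ x ∧ IsIntegral ℤ y ∧ IsIntegral ℤ z ∧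
      15 = 2 * x ^ 2 + 5 * y ^ 2 + 5 * z ^ 2 := by
  let A := ℚ_[13] ⊗[ℚ] K
  let ι : K →+* A := Algebra.TensorProduct.includeRight.toRingHom
  let B : Module.Basis _ ℚ_[13] A :=
    Algebra.TensorProduct.basis ℚ_[13] (NumberField.integralBasis K)
  let _ : TopologicalSpace A := moduleTopology ℚ_[13] A
  have : IsModuleTopology ℚ_[13] A := ⟨rfl⟩
  have : Module.Finite ℚ_[13] A := Module.Finite.of_basis B
  have : IsTopologicalRing A := IsModuleTopology.isTopologicalRing ℚ_[13] A
  have : T2Space A := T2Space.of_injective_continuous B.equivFun.injective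
    (IsModuleTopology.continuous_of_linearMap B.equivFun.toLinearMap)
  have hrepr : ∀ (q : ℚ_[13]) (r : K) i, B.repr (q • ι r) i =
      q * ((NumberField.integralBasis K).repr r i : ℚ) := by
    intro q r i
    have h : q • ι r = q ⊗ₜ[ℚ] r := by
      change q • ((1 : ℚ_[13]) ⊗ₜ[ℚ] r) = q ⊗ₜ[ℚ] r
      rw [TensorProduct.smul_tmul', smul_eq_mul, mul_one]
    rw [h, Algebra.TensorProduct.basis_repr_tmul]
    rfl
  have hcoord : ∀ (q : ℚ_[13]) (r : K) i, ‖q‖ ≤ 1 → IsIntegral ℤ r → ‖B.repr (q • ι r) i‖ ≤ 1 := by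
    intro q r i hq hr
    obtain ⟨m, hm⟩ := integralBasis_repr_eq_intCast K hr i
    rw [hrepr, hm, norm_mul, Rat.cast_intCast]
    exact mul_le_one₀ hq (norm_nonneg _) (Padic.norm_int_le_one m)
  have hcoord_one : ∀ (r : K) i, IsIntegral ℤ r → ‖B.repr (ι r) i‖ ≤ 1 := by
    intro r i hr
    simpa using hcoord 1 r i norm_one.le hr
  have hB : ∀ i, B i = ι (NumberField.integralBasis K i) := by
    exact Algebra.TensorProduct.basis_apply _
  have hBi : ∀ i, IsIntegral ℤ (NumberField.integralBasis K i) := by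
    intro i
    rw [NumberField.integralBasis_apply]
    exact RingOfIntegers.isIntegral_coe _
  obtain ⟨α, hα, hα5⟩ := exists_sq_eq_neg_one
  refine exists_sum_eq_fifteen_of_compact_open hα hα5 ι
    (A₀ := latticeSubring B (fun k => by simpa using hcoord_one 1 k isIntegral_one) fun i j k => by
      rw [hB, hB, ← map_mul]
      exact hcoord_one _ k ((hBi i).mul (hBi j)))
    (isCompact_latticeSubring B) (isOpen_latticeSubring B) (fun r hr i => hcoord_one r i hr) ?_ ?_
    hXY hY ha hYi hX
  · intro r n hr hrA
    refine isIntegral_of_integralBasis_repr K fun i => ?_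
    obtain ⟨m, hm⟩ := integralBasis_repr_eq_intCast K hr i
    have h13 : (13 : K) ^ n * r = (13 ^ n : ℚ) • r := by
      rw [Algebra.smul_def, map_pow, map_ofNat]
    rw [h13, map_smul, Finsupp.smul_apply, smul_eq_mul] at hm
    refine exists_eq_intCast_of_thirteen_pow_mul hm ?_
    have := hrA i
    rwa [← one_smul ℚ_[13] (ι r), hrepr, one_mul] at this
  · intro q hq i
    have := hcoord q 1 i hq isIntegral_one
    rwa [map_one, ← Algebra.algebraMap_eq_smul_one] at this

end Completion

/-- Let `K` be a number field of odd degree over `ℚ`. Then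
`15 = w² + 2x² + 5y² + 5z²` has a solution `w, x, y, z ∈ 𝓞 K` if and only if `K` is not
totally real. -/
theorem statement15 (K : Type) [Field K] [NumberField K]
    (hodd : Odd (Module.finrank ℚ K)) :
    (∃ w x y z : 𝓞 K, (15 : 𝓞 K) = w ^ 2 + 2 * x ^ 2 + 5 * y ^ 2 + 5 * z ^ 2) ↔
      ¬ (∀ σ : K →+* ℂ, ∀ x : K, (σ x).im = 0) := by
  constructor
  · rintro ⟨w, x, y, z, h⟩ hreal
    exact sum_ne_fifteen_of_totallyReal hodd hreal w x y z h
  · intro hreal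
    push Not at hreal
    obtain ⟨φ, x₀, hφ⟩ := hreal
    obtain ⟨X, Y, a, -, hXY, hY, hX, -⟩ := exists_pell hodd φ hφ
    obtain ⟨x, y, z, hx, hy, hz, h⟩ := exists_sum_eq_fifteen_of_pell K (X := X) (Y := Y) (a := a)
      (by simpa [map_ofNat] using congrArg (algebraMap (𝓞 K) K) hXY)
      (RingOfIntegers.coe_ne_zero_iff.2 hY) a.isIntegral_coe Y.isIntegral_coe
      (by simpa [map_ofNat] using congrArg (algebraMap (𝓞 K) K) hX)
    have hlift : ∀ {r : K}, IsIntegral ℤ r → ∃ r' : 𝓞 K, algebraMap (𝓞 K) K r' = r :=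
      fun hr => ⟨⟨_, hr⟩, rfl⟩
    obtain ⟨x, rfl⟩ := hlift hx
    obtain ⟨y, rfl⟩ := hlift hy
    obtain ⟨z, rfl⟩ := hlift hz
    refine ⟨0, x, y, z, RingOfIntegers.ext ?_⟩
    simpa [RingOfIntegers.coe_eq_algebraMap, map_ofNat] using h
end

section
/- Let β be the real root of T³ − 4T − 1 generating the totally real cubic field ℚ(β) of discriminant 229, and let Q(W,X,Y,Z) = 29W² + X² + 2Y² + 4Z² + XZ + YZ. Then 145 = Q(β, β² + 2β − 5, 2β² − 8, −β + 1) in ℤ[β], but there are no integers W, X, Y, Z ∈ ℤ with 145 = Q(W,X,Y,Z). -/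
/-- `-2` is not a square modulo `29`, so `2a² + b²` is anisotropic modulo `29`. -/
lemma dvd_and_dvd_of_dvd_two_mul_sq_add_sq {a b : ℤ} (h : 29 ∣ 2 * a ^ 2 + b ^ 2) :
    29 ∣ a ∧ 29 ∣ b := by
  have key : ∀ u v : ZMod 29, 2 * u ^ 2 + v ^ 2 = 0 → u = 0 ∧ v = 0 := by decide +kernel
  have h0 : ((2 * a ^ 2 + b ^ 2 : ℤ) : ZMod 29) = 0 := (ZMod.intCast_zmod_eq_zero_iff_dvd _ 29).2 h
  push_cast at h0
  obtain ⟨ha, hb⟩ := key _ _ h0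
  exact ⟨(ZMod.intCast_zmod_eq_zero_iff_dvd a 29).1 ha, (ZMod.intCast_zmod_eq_zero_iff_dvd b 29).1 hb⟩

/-- Let `β` be a (real) root of `T³ − 4T − 1`, generating the totally real
cubic field `ℚ(β)` of discriminant 229, and let
`Q(W,X,Y,Z) = 29W² + X² + 2Y² + 4Z² + XZ + YZ`. Then
`145 = Q(β, β² + 2β − 5, 2β² − 8, −β + 1)` in `ℤ[β]`, but `145` is not represented by `Q`
over `ℤ`. -/
theorem statement16 (β : ℝ) (hβ : β ^ 3 - 4 * β - 1 = 0) :
    (145 : ℝ) =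
      29 * β ^ 2 + (β ^ 2 + 2 * β - 5) ^ 2 + 2 * (2 * β ^ 2 - 8) ^ 2 +
        4 * (-β + 1) ^ 2 + (β ^ 2 + 2 * β - 5) * (-β + 1) + (2 * β ^ 2 - 8) * (-β + 1) ∧
    ¬ ∃ W X Y Z : ℤ,
      145 = 29 * W ^ 2 + X ^ 2 + 2 * Y ^ 2 + 4 * Z ^ 2 + X * Z + Y * Z := by
  refine ⟨by linear_combination -(9 * β + 1) * hβ, ?_⟩
  rintro ⟨W, X, Y, Z, h⟩
  have hsq : 2 * (2 * X + Z) ^ 2 + (4 * Y + Z) ^ 2 = 29 * (40 - 8 * W ^ 2 - Z ^ 2) := by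
    linear_combination -8 * h
  obtain ⟨⟨c, hc⟩, ⟨d, hd⟩⟩ := dvd_and_dvd_of_dvd_two_mul_sq_add_sq ⟨_, hsq⟩
  rw [hc, hd] at hsq
  have hsum : 8 * W ^ 2 + Z ^ 2 + 29 * (2 * c ^ 2 + d ^ 2) = 40 := by linarith
  have hc0 : c = 0 := by
    have : c ^ 2 < 1 := by nlinarith [sq_nonneg W, sq_nonneg Z, sq_nonneg d]
    exact pow_eq_zero_iff two_ne_zero |>.1 (le_antisymm (by omega) (sq_nonneg c))
  subst hc0
  have hW : -2 ≤ W ∧ W ≤ 2 := by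
    constructor <;> nlinarith [sq_nonneg Z, sq_nonneg d]
  have hd1 : -1 ≤ d ∧ d ≤ 1 := by
    constructor <;> nlinarith [sq_nonneg Z, sq_nonneg W]
  have hZ : -6 ≤ Z ∧ Z ≤ 6 := by
    constructor <;> nlinarith [sq_nonneg W, sq_nonneg d]
  obtain ⟨hW₁, hW₂⟩ := hW
  obtain ⟨hd₁, hd₂⟩ := hd1
  obtain ⟨hZ₁, hZ₂⟩ := hZ
  clear hsq hc hd h
  interval_cases W <;> interval_cases d <;> interval_cases Z <;> omega
end

section
/- Let Q(W,X,Y,Z) = 29W² + X² + 2Y² + 4Z² + XZ + YZ and let K be a totally real cubic number field. Then there exist w, x, y, z ∈ 𝓞_K with 145 = Q(w,x,y,z) if and only if K is isomorphic to ℚ(β), where β is a root of T³ − 4T − 1 (the totally real cubic field of discriminant 229). -/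
open NumberField

open Polynomial

/-- The ring homomorphism to `ℝ` given by an embedding into `ℂ` with real image. -/
noncomputable def RingHom.toRealOfIm {K : Type*} [Field K] (σ : K →+* ℂ)
    (h : ∀ x, (σ x).im = 0) : K →+* ℝ where
  toFun x := (σ x).re
  map_zero' := by simp
  map_one' := by simp
  map_add' := by simp
  map_mul' x y := by simp [h]

theorem RingHom.ofReal_toRealOfIm {K : Type*} [Field K] (σ : K →+* ℂ)
    (h : ∀ x, (σ x).im = 0) (x : K) : ((σ.toRealOfIm h x : ℝ) : ℂ) = σ x :=
  Complex.ext rfl (by simp [h])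

theorem exists_three_real_embeddings (K : Type*) [Field K] [NumberField K]
    (hTR : ∀ σ : K →+* ℂ, ∀ x : K, (σ x).im = 0) (hdeg : Module.finrank ℚ K = 3) :
    ∃ ρ : Fin 3 → (K →+* ℝ), Function.Injective ρ ∧
      ∀ x : K, ((Algebra.norm ℚ x : ℚ) : ℝ) = ρ 0 x * ρ 1 x * ρ 2 x := by
  have hcard : Fintype.card (K →ₐ[ℚ] ℂ) = 3 := by rw [AlgHom.card, hdeg]
  let e : Fin 3 ≃ (K →ₐ[ℚ] ℂ) := (Fintype.equivFinOfCardEq hcard).symm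
  refine ⟨fun i => (e i : K →+* ℂ).toRealOfIm (hTR _), fun i j hij => e.injective ?_, fun x => ?_⟩
  · ext x
    have := congrArg (fun y : ℝ => (y : ℂ)) (RingHom.congr_fun hij x)
    simpa [RingHom.ofReal_toRealOfIm] using this
  · have h := Algebra.norm_eq_prod_embeddings ℚ ℂ x
    rw [← Equiv.prod_comp e, Fin.prod_univ_three] at h
    apply Complex.ofReal_injective
    push_cast
    simp only [RingHom.ofReal_toRealOfIm]
    simpa using h

theorem exists_powerBasis_gen_eq {F E : Type*} [Field F] [Field E] [Algebra F E]
    [FiniteDimensional F E] (w : E) (h : (minpoly F w).natDegree = Module.finrank F E) :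
    ∃ pb : PowerBasis F E, pb.gen = w := by
  have hw : IsIntegral F w := Algebra.IsIntegral.isIntegral w
  have htop := (Field.primitive_element_iff_minpoly_natDegree_eq F w).2 h
  have : Algebra.adjoin F {w} = ⊤ := by
    rw [← IntermediateField.adjoin_simple_toSubalgebra_of_isAlgebraic hw.isAlgebraic, htop]
    rfl
  exact ⟨PowerBasis.ofAdjoinEqTop hw this, by simp⟩

theorem Polynomial.eq_cubic_of_monic {R : Type*} [CommRing R] {p : R[X]} (hp : p.Monic)
    (h : p.natDegree = 3) :
    p = X ^ 3 + C (p.coeff 2) * X ^ 2 + C (p.coeff 1) * X + C (p.coeff 0) := by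
  conv_lhs => rw [hp.as_sum, h]
  simp [Finset.sum_range_succ]
  ring

/-- An algebraic integer in a cubic field is rational or has a cubic minimal polynomial. -/
theorem exists_int_or_minpoly_eq_cubic {K : Type*} [Field K] [NumberField K]
    (hdeg : Module.finrank ℚ K = 3) (w : 𝓞 K) :
    (∃ n : ℤ, w = n) ∨ ∃ a b c : ℤ,
      minpoly ℚ (w : K) = X ^ 3 + C (a : ℚ) * X ^ 2 + C (b : ℚ) * X + C (c : ℚ) := by
  have hint : IsIntegral ℤ (w : K) := w.isIntegral_coe
  have hint' : IsIntegral ℚ (w : K) := Algebra.IsIntegral.isIntegral _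
  have hmap := minpoly.isIntegrallyClosed_eq_field_fractions' ℚ hint
  have hmonic := minpoly.monic hint
  have hdvd := minpoly.degree_dvd hint'
  rw [hdeg, Nat.dvd_prime Nat.prime_three] at hdvd
  rcases hdvd with h1 | h3
  · left
    obtain ⟨q, hq⟩ := minpoly.mem_range_of_degree_eq_one ℚ (w : K)
      ((Polynomial.degree_eq_iff_natDegree_eq_of_pos one_pos).2 h1)
    have : IsIntegral ℤ q := by
      rw [← hq] at hint
      exact (isIntegral_algebraMap_iff (algebraMap ℚ K).injective).1 hint
    obtain ⟨n, rfl⟩ := IsIntegrallyClosed.isIntegral_iff.1 this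
    exact ⟨n, RingOfIntegers.ext (by simp [← hq])⟩
  · right
    refine ⟨(minpoly ℤ (w : K)).coeff 2, (minpoly ℤ (w : K)).coeff 1,
      (minpoly ℤ (w : K)).coeff 0, ?_⟩
    conv_lhs => rw [hmap, Polynomial.eq_cubic_of_monic hmonic
        (by rwa [hmap, hmonic.natDegree_map] at h3)]
    simp only [Polynomial.map_add, Polynomial.map_mul, Polynomial.map_pow, Polynomial.map_X,
        Polynomial.map_C]
    rfl

/-- Vieta's formulas for three distinct roots of a monic cubic. -/
theorem vieta_cubic {F : Type*} [Field F] {a b c r s t : F} (hrs : r ≠ s) (hrt : r ≠ t)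
    (hst : s ≠ t) (hr : r ^ 3 + a * r ^ 2 + b * r + c = 0) (hs : s ^ 3 + a * s ^ 2 + b * s + c = 0)
    (ht : t ^ 3 + a * t ^ 2 + b * t + c = 0) :
    a = -(r + s + t) ∧ b = r * s + r * t + s * t ∧ c = -(r * s * t) := by
  have h1 : r ^ 2 + r * s + s ^ 2 + a * (r + s) + b = 0 :=
    mul_left_cancel₀ (sub_ne_zero.2 hrs) (by linear_combination hr - hs)
  have h2 : r ^ 2 + r * t + t ^ 2 + a * (r + t) + b = 0 :=
    mul_left_cancel₀ (sub_ne_zero.2 hrt) (by linear_combination hr - ht)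
  have ha : a + (r + s + t) = 0 :=
    mul_left_cancel₀ (sub_ne_zero.2 hst) (by linear_combination h1 - h2)
  refine ⟨by linear_combination ha, by linear_combination h1 - (r + s) * ha, ?_⟩
  linear_combination hr - r * h1 + r * s * ha

theorem ZMod.eq_zero_of_two_mul_sq_add_sq :
    ∀ A B : ZMod 29, 2 * A ^ 2 + B ^ 2 = 0 → A = 0 ∧ B = 0 := by
  decide +kernel

/-- If `8m` is a nonsquare modulo `29`, the form `2A² + B² + 29z² - 232mt²` vanishes over `ℤ` only
for `t = 0`. -/
theorem eq_zero_of_int_isotropic {m : ℤ}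
    (hm : ∀ z t : ZMod 29, z ^ 2 = 8 * m * t ^ 2 → z = 0 ∧ t = 0) (n : ℕ) :
    ∀ A B z t : ℤ, t.natAbs ≤ n → 2 * A ^ 2 + B ^ 2 + 29 * z ^ 2 = 232 * m * t ^ 2 → t = 0 := by
  induction n with
  | zero => intro A B z t ht _; omega
  | succ n ih =>
    intro A B z t ht h
    have h1 := congrArg (Int.cast : ℤ → ZMod 29) h
    push_cast at h1
    have h29 : (29 : ZMod 29) = 0 := by decide
    have h232 : (232 : ZMod 29) = 0 := by decide
    obtain ⟨hA, hB⟩ := ZMod.eq_zero_of_two_mul_sq_add_sq A B (by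
      linear_combination h1 - z ^ 2 * h29 + m * t ^ 2 * h232)
    rw [ZMod.intCast_zmod_eq_zero_iff_dvd _ 29] at hA hB
    obtain ⟨A, rfl⟩ := hA
    obtain ⟨B, rfl⟩ := hB
    have h2 : 58 * A ^ 2 + 29 * B ^ 2 + z ^ 2 = 8 * m * t ^ 2 := by push_cast at h; linarith
    have h3 := congrArg (Int.cast : ℤ → ZMod 29) h2
    push_cast at h3
    have h58 : (58 : ZMod 29) = 0 := by decide
    obtain ⟨hz, ht'⟩ := hm z t (by linear_combination h3 - A ^ 2 * h58 - B ^ 2 * h29)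
    rw [ZMod.intCast_zmod_eq_zero_iff_dvd _ 29] at hz ht'
    obtain ⟨z, rfl⟩ := hz
    obtain ⟨t, rfl⟩ := ht'
    have : t = 0 := ih A B z t (by omega) (by push_cast at h2; linarith)
    simp [this]

theorem rat_form_ne {m : ℤ} (hm : ∀ z t : ZMod 29, z ^ 2 = 8 * m * t ^ 2 → z = 0 ∧ t = 0)
    (A B z : ℚ) : 2 * A ^ 2 + B ^ 2 + 29 * z ^ 2 ≠ 232 * m := by
  intro h
  have := eq_zero_of_int_isotropic hm _ (A.num * (B.den * z.den)) (B.num * (A.den * z.den))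
    (z.num * (A.den * B.den)) (A.den * B.den * z.den) le_rfl (by
      have hA := A.num_div_den
      have hB := B.num_div_den
      have hz := z.num_div_den
      have := A.den_ne_zero
      have := B.den_ne_zero
      have := z.den_ne_zero
      rw [← hA, ← hB, ← hz] at h
      field_simp at h
      have h' : (2 * (A.num * (B.den * z.den)) ^ 2 + (B.num * (A.den * z.den)) ^ 2 +
        29 * (z.num * (A.den * B.den)) ^ 2 : ℚ) = 232 * m * (A.den * B.den * z.den) ^ 2 := by
        linear_combination h
      exact_mod_cast h')
  simp at this

/-- Springer's argument: a value not taken over `ℚ` by `2A² + B² + 29z²` is not taken over a cubic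
field either. -/
theorem cubic_form_ne {K : Type*} [Field K] [NumberField K] (hdeg : Module.finrank ℚ K = 3) {k : ℚ}
    (hk : ∀ A B z : ℚ, 2 * A ^ 2 + B ^ 2 + 29 * z ^ 2 ≠ k) (A B z : K) :
    2 * A ^ 2 + B ^ 2 + 29 * z ^ 2 ≠ algebraMap ℚ K k := by
  intro h
  let pb := Field.powerBasisOfFiniteOfSeparable ℚ K
  have hdim : pb.dim = 3 := by rw [← hdeg, pb.finrank]
  have hf : (minpoly ℚ pb.gen).natDegree = 3 := by rw [pb.natDegree_minpoly, hdim]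
  obtain ⟨p, hp, rfl⟩ := pb.exists_eq_aeval A
  obtain ⟨q, hq, rfl⟩ := pb.exists_eq_aeval B
  obtain ⟨s, hs, rfl⟩ := pb.exists_eq_aeval z
  rw [hdim] at hp hq hs
  have dvd : minpoly ℚ pb.gen ∣ 2 * p ^ 2 + q ^ 2 + 29 * s ^ 2 - C k :=
    minpoly.dvd _ _ (by
      simp only [map_sub, map_add, map_mul, map_pow, map_ofNat, aeval_C, h, sub_self])
  have hroot : ∀ x, eval x (2 * p ^ 2 + q ^ 2 + 29 * s ^ 2 - C k) ≠ 0 := fun x hx =>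
    hk (eval x p) (eval x q) (eval x s) (by simpa [sub_eq_zero] using hx)
  set P := 2 * p ^ 2 + q ^ 2 + 29 * s ^ 2 - C k with hP
  obtain ⟨g, hg⟩ := dvd
  have hP0 : P ≠ 0 := fun h0 => hroot 0 (by simp [h0])
  have hg0 : g ≠ 0 := by rintro rfl; simp [hg] at hP0
  have hdegP : P.natDegree = 3 + g.natDegree := by
    rw [hg, natDegree_mul (minpoly.ne_zero (Algebra.IsIntegral.isIntegral _)) hg0, hf]
  have hdegree : ∀ d, p.natDegree ≤ d → q.natDegree ≤ d → s.natDegree ≤ d →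
      P.natDegree ≤ d * 2 := by
    intro d h1 h2 h3
    have e2 : (2 : ℚ[X]) = C 2 := rfl
    have e29 : (29 : ℚ[X]) = C 29 := rfl
    rw [hP, e2, e29]
    compute_degree
    omega
  have hle := hdegree 2 (by omega) (by omega) (by omega)
  have hg1 : g.natDegree = 1 := by
    by_contra hne
    have h3 : P.coeff 4 = 0 := coeff_eq_zero_of_natDegree_lt (by omega)
    have e2 : (2 : ℚ[X]) = C 2 := rfl
    have e29 : (29 : ℚ[X]) = C 29 := rfl
    have c2 : ∀ u : ℚ[X], u.natDegree ≤ 2 → (u ^ 2).coeff 4 = u.coeff 2 ^ 2 := fun u hu =>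
      coeff_pow_of_natDegree_le (m := 2) hu
    rw [hP, e2, e29, coeff_sub, coeff_add, coeff_add, coeff_C_mul, coeff_C_mul, c2 p (by omega),
      c2 q (by omega), c2 s (by omega), coeff_C_of_ne_zero (by norm_num)] at h3
    have sp := sq_nonneg (p.coeff 2)
    have sq := sq_nonneg (q.coeff 2)
    have ss := sq_nonneg (s.coeff 2)
    have drop : ∀ u : ℚ[X], u.natDegree < 3 → u.coeff 2 = 0 → u.natDegree ≤ 1 := by
      intro u hu h0
      by_contra hlt
      have h2 : u.natDegree = 2 := by omega
      rw [← h2, coeff_natDegree, leadingCoeff_eq_zero] at h0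
      simp [h0] at h2
    have hp2 : p.coeff 2 = 0 := by nlinarith
    have hq2 : q.coeff 2 = 0 := by nlinarith
    have hs2 : s.coeff 2 = 0 := by nlinarith
    have := hdegree 1 (drop p hp hp2) (drop q hq hq2) (drop s hs hs2)
    omega
  obtain ⟨x, hx⟩ := exists_root_of_degree_eq_one
    ((degree_eq_iff_natDegree_eq_of_pos one_pos).2 hg1)
  exact hroot x (by rw [hg, eval_mul, hx.eq_zero, mul_zero])

instance fact_prime_twentyNine : Fact (Nat.Prime 29) := ⟨by norm_num⟩

theorem PadicInt.toZMod_eq_zero_iff {p : ℕ} [Fact p.Prime] (x : ℤ_[p]) :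
    PadicInt.toZMod x = 0 ↔ ‖x‖ < 1 := by
  rw [← RingHom.mem_ker, PadicInt.ker_toZMod, IsLocalRing.mem_maximalIdeal, PadicInt.mem_nonunits]

/-- Hensel's lemma for a simple root modulo `p` of an integral polynomial. -/
theorem exists_padicInt_root {p : ℕ} [Fact p.Prime] (F : ℤ[X]) (r : ZMod p)
    (h0 : aeval r F = 0) (h1 : aeval r (derivative F) ≠ 0) :
    ∃ ρ : ℤ_[p], aeval ρ F = 0 ∧ PadicInt.toZMod ρ = r := by
  obtain ⟨x, rfl⟩ := ZMod.ringHom_surjective (PadicInt.toZMod (p := p)) r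
  have hmap : ∀ G : ℤ[X], aeval (PadicInt.toZMod x) G = PadicInt.toZMod (aeval x G) := fun G =>
    aeval_algHom_apply (PadicInt.toZMod (p := p)).toIntAlgHom x G
  rw [hmap, PadicInt.toZMod_eq_zero_iff] at h0
  rw [hmap, Ne, PadicInt.toZMod_eq_zero_iff] at h1
  have h1' : ‖aeval x (derivative F)‖ = 1 := le_antisymm (PadicInt.norm_le_one _) (not_lt.1 h1)
  obtain ⟨ρ, hρ, hd, -⟩ := hensels_lemma (F := F) (a := x) (by rw [h1']; simpa using h0)
  refine ⟨ρ, hρ, ?_⟩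
  rw [h1', ← PadicInt.toZMod_eq_zero_iff, map_sub, sub_eq_zero] at hd
  exact hd

/-- The local obstruction at a prime above `29` of degree one. -/
theorem form_ne_of_simple_root {K : Type*} [Field K] [NumberField K]
    (hdeg : Module.finrank ℚ K = 3) {w : 𝓞 K} {F : ℤ[X]} (hF : F.natDegree = 3)
    (hw : minpoly ℚ (w : K) = F.map (algebraMap ℤ ℚ)) {r : ZMod 29} (h0 : aeval r F = 0)
    (h1 : aeval r (derivative F) ≠ 0) (hr : ∀ z : ZMod 29, 8 * (5 - r ^ 2) ≠ z ^ 2)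
    (A B z : 𝓞 K) : 2 * A ^ 2 + B ^ 2 + 29 * z ^ 2 ≠ 232 * (5 - w ^ 2) := by
  intro h
  obtain ⟨ρ, hρ, hρr⟩ := exists_padicInt_root F r h0 h1
  obtain ⟨pb, hpb⟩ := exists_powerBasis_gen_eq (F := ℚ) (w : K) (by
    rw [hdeg, hw, natDegree_map_eq_of_injective (algebraMap ℤ ℚ).injective_int, hF])
  let φ : K →ₐ[ℚ] ℚ_[29] := pb.lift (algebraMap ℤ_[29] ℚ_[29] ρ) (by
    rw [hpb, hw, aeval_map_algebraMap, aeval_algebraMap_apply, hρ, map_zero])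
  have hφ : φ w = algebraMap ℤ_[29] ℚ_[29] ρ := by
    rw [← hpb]
    exact pb.lift_gen _ _
  have integral : ∀ x : 𝓞 K, ∃ y : ℤ_[29], algebraMap ℤ_[29] ℚ_[29] y = φ x := fun x =>
    IsIntegrallyClosed.isIntegral_iff.1
      ((x.isIntegral_coe.map (φ.restrictScalars ℤ)).tower_top (A := ℤ_[29]))
  obtain ⟨A', hA⟩ := integral A
  obtain ⟨B', hB⟩ := integral B
  obtain ⟨z', hz⟩ := integral z
  have e : 2 * A' ^ 2 + B' ^ 2 + 29 * z' ^ 2 = 232 * (5 - ρ ^ 2) := by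
    apply IsFractionRing.injective ℤ_[29] ℚ_[29]
    have := congrArg (fun x : 𝓞 K => φ x) h
    simp only [map_add, map_mul, map_pow, map_sub, map_ofNat] at this ⊢
    rw [hA, hB, hz, ← hφ]
    exact this
  have h29 : (29 : ZMod 29) = 0 := by decide
  have h232 : (232 : ZMod 29) = 0 := by decide
  have e1 := congrArg PadicInt.toZMod e
  simp only [map_add, map_mul, map_pow, map_sub, map_ofNat, h29, h232, zero_mul, add_zero] at e1
  obtain ⟨hA0, hB0⟩ := ZMod.eq_zero_of_two_mul_sq_add_sq _ _ e1
  rw [← RingHom.mem_ker, PadicInt.ker_toZMod, PadicInt.maximalIdeal_eq_span_p,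
    Ideal.mem_span_singleton] at hA0 hB0
  obtain ⟨A₁, rfl⟩ := hA0
  obtain ⟨B₁, rfl⟩ := hB0
  have e2 : 29 * (2 * A₁ ^ 2 + B₁ ^ 2) + z' ^ 2 = 8 * (5 - ρ ^ 2) := by
    have : (29 : ℤ_[29]) ≠ 0 := by norm_num
    apply mul_left_cancel₀ this
    push_cast at e
    linear_combination e
  have e3 := congrArg PadicInt.toZMod e2
  simp only [map_add, map_mul, map_pow, map_sub, map_ofNat, h29, hρr, zero_mul, zero_add] at e3
  exact hr _ e3.symm

/-- `-2` is not a square in the field with `29 ^ 3` elements. -/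
theorem eq_zero_of_two_mul_sq_add_sq {L : Type*} [Field L] [CharP L 29]
    (hcard : Nat.card L = 29 ^ 3) {A B : L} (h : 2 * A ^ 2 + B ^ 2 = 0) : A = 0 ∧ B = 0 := by
  have : Finite L := Nat.finite_of_card_ne_zero (by rw [hcard]; norm_num)
  have := Fintype.ofFinite L
  have h29 : (29 : L) = 0 := by exact_mod_cast CharP.cast_eq_zero L 29
  have hA : A = 0 := by
    by_contra hA
    have hB : B ≠ 0 := by
      rintro rfl
      have h2 : (2 : L) = 0 := by simpa [hA] using h
      exact one_ne_zero (α := L) (by linear_combination h29 - 14 * h2)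
    have ht : (B / A) ^ 2 = -2 := by
      field_simp
      linear_combination h
    have hpow := FiniteField.pow_card_sub_one_eq_one (B / A) (div_ne_zero hB hA)
    rw [← Nat.card_eq_fintype_card, hcard,
      show 29 ^ 3 - 1 = 2 * (14 * 871) by norm_num, pow_mul, pow_mul, ht,
      show (-2 : L) ^ 14 = -1 by linear_combination 565 * h29,
      Odd.neg_one_pow (by decide)] at hpow
    exact one_ne_zero (α := L) (by linear_combination h29 + 14 * hpow)
  subst hA
  exact ⟨rfl, by simpa using h⟩

/-- If the minimal polynomial of an integer in a cubic field has no root modulo `29`, then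
`2A² + B²` is anisotropic modulo `29`. -/
theorem dvd_of_dvd_two_mul_sq_add_sq {K : Type*} [Field K] [NumberField K]
    (hdeg : Module.finrank ℚ K = 3) {w : 𝓞 K} {F : ℤ[X]} (hF : F.Monic) (hF3 : F.natDegree = 3)
    (hw : aeval w F = 0) (hroot : ∀ r : ZMod 29, aeval r F ≠ 0) {A B : 𝓞 K}
    (h : 29 ∣ 2 * A ^ 2 + B ^ 2) : 29 ∣ A ∧ 29 ∣ B := by
  let I : Ideal (𝓞 K) := Ideal.span {29}
  have hcardR : Nat.card (𝓞 K ⧸ I) = 29 ^ 3 := by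
    have h1 : Ideal.absNorm I = 29 ^ 3 := by
      have := Algebra.norm_algebraMap (S := 𝓞 K) (29 : ℤ)
      rw [RingOfIntegers.rank, hdeg] at this
      rw [Ideal.absNorm_span_singleton, show (29 : 𝓞 K) = algebraMap ℤ (𝓞 K) 29 by simp, this]
      rfl
    rwa [Ideal.absNorm_apply, Submodule.cardQuot_apply] at h1
  have hfinR : Finite (𝓞 K ⧸ I) := Nat.finite_of_card_ne_zero (by rw [hcardR]; norm_num)
  have : Nontrivial (𝓞 K ⧸ I) := Finite.one_lt_card_iff_nontrivial.1 (by rw [hcardR]; norm_num)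
  have h29 : ((29 : ℕ) : 𝓞 K ⧸ I) = 0 :=
    Ideal.Quotient.eq_zero_iff_mem.2 (Ideal.mem_span_singleton_self _)
  have : CharP (𝓞 K ⧸ I) 29 := (CharP.charP_iff_prime_eq_zero (by norm_num)).2 h29
  let f : (ZMod 29)[X] := F.map (algebraMap ℤ (ZMod 29))
  have hf3 : f.natDegree = 3 := by rw [hF.natDegree_map, hF3]
  have hirr : Irreducible f := irreducible_of_degree_le_three_of_not_isRoot (by simp [hf3])
    fun r hr => hroot r (by rwa [IsRoot, eval_map_algebraMap] at hr)
  have : Fact (Irreducible f) := ⟨hirr⟩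
  have hcardL : Nat.card (AdjoinRoot f) = 29 ^ 3 := by
    have := (AdjoinRoot.powerBasis hirr.ne_zero).finite
    rw [Module.natCard_eq_pow_finrank (K := ZMod 29), Nat.card_zmod,
      (AdjoinRoot.powerBasis hirr.ne_zero).finrank, AdjoinRoot.powerBasis_dim, hf3]
  let j : AdjoinRoot f →+* 𝓞 K ⧸ I :=
    AdjoinRoot.lift (ZMod.castHom (dvd_refl 29) _) (Ideal.Quotient.mk I w) (by
      rw [eval₂_map, RingHom.ext_int (RingHom.comp _ _) ((Ideal.Quotient.mk I).comp (algebraMap ℤ _)),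
        ← hom_eval₂]
      exact (congrArg _ hw).trans (map_zero _))
  have hbij : Function.Bijective j :=
    (Nat.bijective_iff_injective_and_card j).2 ⟨j.injective, by rw [hcardL, hcardR]⟩
  have : CharP (AdjoinRoot f) 29 := charP_of_injective_algebraMap
    (algebraMap (ZMod 29) (AdjoinRoot f)).injective 29
  obtain ⟨α, hα⟩ := hbij.2 (Ideal.Quotient.mk I A)
  obtain ⟨γ, hγ⟩ := hbij.2 (Ideal.Quotient.mk I B)
  have h0 : 2 * α ^ 2 + γ ^ 2 = 0 := by
    apply j.injective
    simp only [map_add, map_mul, map_pow, map_ofNat, map_zero, hα, hγ]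
    have := Ideal.Quotient.eq_zero_iff_mem.2 (Ideal.mem_span_singleton.2 h : _ ∈ I)
    rwa [map_add, map_mul, map_pow, map_pow, map_ofNat] at this
  obtain ⟨rfl, rfl⟩ := eq_zero_of_two_mul_sq_add_sq hcardL h0
  rw [map_zero] at hα hγ
  exact ⟨Ideal.mem_span_singleton.1 (Ideal.Quotient.eq_zero_iff_mem.1 hα.symm),
    Ideal.mem_span_singleton.1 (Ideal.Quotient.eq_zero_iff_mem.1 hγ.symm)⟩

theorem cubic_cases : ∀ a ∈ Finset.Icc (-6 : ℤ) 6, ∀ b ∈ Finset.Icc (-7 : ℤ) 15,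
    ∀ c ∈ Finset.Icc (-11 : ℤ) 11,
    0 ≤ 15 - (a ^ 2 - 2 * b) →
    0 ≤ 75 - 10 * (a ^ 2 - 2 * b) + (b ^ 2 - 2 * a * c) →
    0 ≤ 125 - 25 * (a ^ 2 - 2 * b) + 5 * (b ^ 2 - 2 * a * c) - c ^ 2 →
    0 ≤ a ^ 2 * b ^ 2 - 4 * b ^ 3 - 4 * a ^ 3 * c - 27 * c ^ 2 + 18 * a * b * c →
    (∃ t ∈ Finset.Icc (-3 : ℤ) 3, t ^ 3 + a * t ^ 2 + b * t + c = 0) ∨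
    (∃ r : ZMod 29, r ^ 3 + a * r ^ 2 + b * r + c = 0 ∧ 3 * r ^ 2 + 2 * a * r + b ≠ 0 ∧
      ∀ z : ZMod 29, 8 * (5 - r ^ 2) ≠ z ^ 2) ∨
    ((∀ r : ZMod 29, r ^ 3 + a * r ^ 2 + b * r + c ≠ 0) ∧
      (125 - 25 * (a ^ 2 - 2 * b) + 5 * (b ^ 2 - 2 * a * c) - c ^ 2 = 1 ∨
        125 - 25 * (a ^ 2 - 2 * b) + 5 * (b ^ 2 - 2 * a * c) - c ^ 2 = 19)) ∨
    (a = 0 ∧ b = -4 ∧ (c = 1 ∨ c = -1)) := by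
  decide +kernel

/-- The monic cubics over `ℤ` with three real roots in `[-√5, √5]`. -/
theorem cubic_cases_of_roots {a b c : ℤ} {r s t : ℝ} (hr : r ^ 2 ≤ 5) (hs : s ^ 2 ≤ 5)
    (ht : t ^ 2 ≤ 5) (ha : (a : ℝ) = -(r + s + t)) (hb : (b : ℝ) = r * s + r * t + s * t)
    (hc : (c : ℝ) = -(r * s * t)) :
    (∃ t : ℤ, t ^ 3 + a * t ^ 2 + b * t + c = 0) ∨
    (∃ r : ZMod 29, r ^ 3 + a * r ^ 2 + b * r + c = 0 ∧ 3 * r ^ 2 + 2 * a * r + b ≠ 0 ∧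
      ∀ z : ZMod 29, 8 * (5 - r ^ 2) ≠ z ^ 2) ∨
    ((∀ r : ZMod 29, r ^ 3 + a * r ^ 2 + b * r + c ≠ 0) ∧
      ((5 - r ^ 2) * (5 - s ^ 2) * (5 - t ^ 2) = 1 ∨
        (5 - r ^ 2) * (5 - s ^ 2) * (5 - t ^ 2) = 19)) ∨
    (a = 0 ∧ b = -4 ∧ (c = 1 ∨ c = -1)) := by
  have hr' := sub_nonneg.2 hr
  have hs' := sub_nonneg.2 hs
  have ht' := sub_nonneg.2 ht
  have e1 : ((15 - (a ^ 2 - 2 * b) : ℤ) : ℝ) = (5 - r ^ 2) + (5 - s ^ 2) + (5 - t ^ 2) := by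
    push_cast; rw [ha, hb]; ring
  have e2 : ((75 - 10 * (a ^ 2 - 2 * b) + (b ^ 2 - 2 * a * c) : ℤ) : ℝ) =
      (5 - r ^ 2) * (5 - s ^ 2) + (5 - r ^ 2) * (5 - t ^ 2) + (5 - s ^ 2) * (5 - t ^ 2) := by
    push_cast; rw [ha, hb, hc]; ring
  have e3 : ((125 - 25 * (a ^ 2 - 2 * b) + 5 * (b ^ 2 - 2 * a * c) - c ^ 2 : ℤ) : ℝ) =
      (5 - r ^ 2) * (5 - s ^ 2) * (5 - t ^ 2) := by
    push_cast; rw [ha, hb, hc]; ring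
  have e4 : ((a ^ 2 * b ^ 2 - 4 * b ^ 3 - 4 * a ^ 3 * c - 27 * c ^ 2 + 18 * a * b * c : ℤ) : ℝ) =
      ((r - s) * (r - t) * (s - t)) ^ 2 := by
    push_cast; rw [ha, hb, hc]; ring
  have i1 : 0 ≤ 15 - (a ^ 2 - 2 * b) := by
    rw [← Int.cast_nonneg_iff (R := ℝ), e1]; positivity
  have i2 : 0 ≤ 75 - 10 * (a ^ 2 - 2 * b) + (b ^ 2 - 2 * a * c) := by
    rw [← Int.cast_nonneg_iff (R := ℝ), e2]; positivity
  have i3 : 0 ≤ 125 - 25 * (a ^ 2 - 2 * b) + 5 * (b ^ 2 - 2 * a * c) - c ^ 2 := by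
    rw [← Int.cast_nonneg_iff (R := ℝ), e3]; positivity
  have i4 : 0 ≤ a ^ 2 * b ^ 2 - 4 * b ^ 3 - 4 * a ^ 3 * c - 27 * c ^ 2 + 18 * a * b * c := by
    rw [← Int.cast_nonneg_iff (R := ℝ), e4]; positivity
  have hab : 3 * b ≤ a ^ 2 := by
    have : (3 * b : ℝ) ≤ a ^ 2 := by
      rw [ha, hb]; nlinarith [sq_nonneg (r - s), sq_nonneg (r - t), sq_nonneg (s - t)]
    exact_mod_cast this
  have hc2 : c ^ 2 ≤ 125 := by
    have : (c : ℝ) ^ 2 ≤ 125 := by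
      calc (c : ℝ) ^ 2 = r ^ 2 * s ^ 2 * t ^ 2 := by rw [hc]; ring
        _ ≤ 5 * 5 * 5 := by gcongr
        _ = 125 := by norm_num
    exact_mod_cast this
  have hbox := cubic_cases a (Finset.mem_Icc.2 ⟨by nlinarith, by nlinarith⟩)
    b (Finset.mem_Icc.2 ⟨by nlinarith, by nlinarith⟩)
    c (Finset.mem_Icc.2 ⟨by nlinarith, by nlinarith⟩) i1 i2 i3 i4
  rcases hbox with ⟨t, -, ht⟩ | h | ⟨h, h' | h'⟩ | h
  · exact Or.inl ⟨t, ht⟩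
  · exact Or.inr (Or.inl h)
  · exact Or.inr (Or.inr (Or.inl ⟨h, Or.inl (by rw [← e3, h', Int.cast_one])⟩))
  · exact Or.inr (Or.inr (Or.inl ⟨h, Or.inr (by rw [← e3, h']; norm_num)⟩))
  · exact Or.inr (Or.inr (Or.inr h))

/-- When `2A² + B²` is anisotropic modulo `29`, the form cannot represent an integer of small
norm. -/
theorem form_ne_of_norm_eq {K : Type*} [Field K] [NumberField K] {ρ : Fin 3 → (K →+* ℝ)}
    (hnorm : ∀ x : K, ((Algebra.norm ℚ x : ℚ) : ℝ) = ρ 0 x * ρ 1 x * ρ 2 x)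
    (hdvd : ∀ A B : 𝓞 K, 29 ∣ 2 * A ^ 2 + B ^ 2 → 29 ∣ A ∧ 29 ∣ B) {m : 𝓞 K}
    (hm : ρ 0 m * ρ 1 m * ρ 2 m = 1 ∨ ρ 0 m * ρ 1 m * ρ 2 m = 19) (A B z : 𝓞 K) :
    2 * A ^ 2 + B ^ 2 + 29 * z ^ 2 ≠ 232 * m := by
  intro h
  obtain ⟨⟨A, rfl⟩, ⟨B, rfl⟩⟩ := hdvd A B ⟨8 * m - z ^ 2, by linear_combination h⟩
  have hnormZ : ∀ x : 𝓞 K, ((Algebra.norm ℤ x : ℤ) : ℝ) = ρ 0 x * ρ 1 x * ρ 2 x := fun x => by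
    rw [← hnorm, ← Algebra.coe_norm_int]; norm_cast
  have h1 : 29 * (2 * A ^ 2 + B ^ 2) + z ^ 2 = 8 * m :=
    mul_left_cancel₀ (by norm_num : (29 : 𝓞 K) ≠ 0) (by linear_combination h)
  have hi : ∀ i, 29 * ρ i (2 * A ^ 2 + B ^ 2 : 𝓞 K) + ρ i z ^ 2 = 8 * ρ i m := fun i => by
    have := congrArg (fun x : 𝓞 K => ρ i x) h1
    simpa only [map_add, map_mul, map_pow, map_ofNat] using this
  have hpos : ∀ i, 0 ≤ ρ i (2 * A ^ 2 + B ^ 2 : 𝓞 K) := fun i => by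
    simp only [map_add, map_mul, map_pow, map_ofNat]; positivity
  have hle : ∀ i, 29 * ρ i (2 * A ^ 2 + B ^ 2 : 𝓞 K) ≤ 8 * ρ i m := fun i => by
    linarith [hi i, sq_nonneg (ρ i z)]
  have hu0 : Algebra.norm ℤ (2 * A ^ 2 + B ^ 2) = 0 := by
    have h0 : 0 ≤ ((Algebra.norm ℤ (2 * A ^ 2 + B ^ 2) : ℤ) : ℝ) := by
      rw [hnormZ]
      exact mul_nonneg (mul_nonneg (hpos 0) (hpos 1)) (hpos 2)
    have hlt : ((Algebra.norm ℤ (2 * A ^ 2 + B ^ 2) : ℤ) : ℝ) < 1 := by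
      have hprod : (29 * ρ 0 (2 * A ^ 2 + B ^ 2 : 𝓞 K)) * (29 * ρ 1 (2 * A ^ 2 + B ^ 2 : 𝓞 K)) *
          (29 * ρ 2 (2 * A ^ 2 + B ^ 2 : 𝓞 K)) ≤ (8 * ρ 0 m) * (8 * ρ 1 m) * (8 * ρ 2 m) := by
        have n0 := hpos 0
        have n1 := hpos 1
        have n2 := hpos 2
        have l0 := hle 0
        have l1 := hle 1
        have l2 := hle 2
        have p0 : 0 ≤ 8 * ρ 0 m := by linarith
        have p1 : 0 ≤ 8 * ρ 1 m := by linarith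
        gcongr
      rw [hnormZ]
      rcases hm with hm | hm <;> nlinarith
    have h0' : (0 : ℤ) ≤ Algebra.norm ℤ (2 * A ^ 2 + B ^ 2) := by exact_mod_cast h0
    have hlt' : Algebra.norm ℤ (2 * A ^ 2 + B ^ 2) < 1 := by exact_mod_cast hlt
    omega
  rw [Algebra.norm_eq_zero_iff] at hu0
  simp only [hu0, map_zero, mul_zero, zero_add] at hi
  have hsq : ((Algebra.norm ℤ z : ℤ) : ℝ) ^ 2 = 512 * (ρ 0 m * ρ 1 m * ρ 2 m) := by
    rw [hnormZ, mul_pow, mul_pow, hi, hi, hi]; ring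
  have hmod : Algebra.norm ℤ z ^ 2 = 512 ∨ Algebra.norm ℤ z ^ 2 = 9728 := by
    rcases hm with hm | hm <;> rw [hm] at hsq <;> norm_num at hsq
    · exact Or.inl (by exact_mod_cast hsq)
    · exact Or.inr (by exact_mod_cast hsq)
  have hthree : ∀ n : ZMod 3, n ^ 2 ≠ 2 := by decide
  rcases hmod with hmod | hmod
  · exact hthree (Algebra.norm ℤ z : ℤ) (by
      exact_mod_cast congrArg (Int.cast : ℤ → ZMod 3) hmod)
  · exact hthree (Algebra.norm ℤ z : ℤ) (by
      exact_mod_cast congrArg (Int.cast : ℤ → ZMod 3) hmod)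

theorem rational_form_ne {K : Type*} [Field K] [NumberField K] (hdeg : Module.finrank ℚ K = 3)
    {n : ℤ} (hn : n ^ 2 ≤ 5) (A B z : 𝓞 K) :
    2 * A ^ 2 + B ^ 2 + 29 * z ^ 2 ≠ 232 * (5 - (n : 𝓞 K) ^ 2) := by
  have hmod : ∀ z t : ZMod 29, z ^ 2 = 8 * ((5 - n ^ 2 : ℤ) : ZMod 29) * t ^ 2 →
      z = 0 ∧ t = 0 := by
    have h1 : n ≤ 2 := by nlinarith
    have h2 : -2 ≤ n := by nlinarith
    interval_cases n <;> decide +kernel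
  intro h
  refine cubic_form_ne hdeg (rat_form_ne hmod) (A : K) B z ?_
  have := congrArg (fun x : 𝓞 K => (x : K)) h
  simp only [map_add, map_mul, map_pow, map_sub, map_ofNat, map_intCast] at this
  push_cast
  rw [this]
  simp

/-- Let `Q(W,X,Y,Z) = 29W² + X² + 2Y² + 4Z² + XZ + YZ` and let `K` be a
totally real cubic number field. Then `145 = Q(w,x,y,z)` has a solution `w, x, y, z ∈ 𝓞 K`
if and only if `K` is isomorphic to `ℚ(β)`, where `β` is a root of `T³ − 4T − 1` (the totally
real cubic field of discriminant 229); since `K` is cubic, this is equivalent to `K`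
containing a root of `T³ − 4T − 1`. -/
theorem statement17 (K : Type) [Field K] [NumberField K]
    (hTR : ∀ σ : K →+* ℂ, ∀ x : K, (σ x).im = 0)
    (hdeg : Module.finrank ℚ K = 3) :
    (∃ w x y z : 𝓞 K,
        (145 : 𝓞 K) = 29 * w ^ 2 + x ^ 2 + 2 * y ^ 2 + 4 * z ^ 2 + x * z + y * z) ↔
      ∃ β : K, β ^ 3 - 4 * β - 1 = 0 := by
  constructor
  · rintro ⟨w, x, y, z, h⟩
    have hform : 2 * (2 * x + z) ^ 2 + (4 * y + z) ^ 2 + 29 * z ^ 2 = 232 * (5 - w ^ 2) := by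
      linear_combination -8 * h
    obtain ⟨ρ, hinj, hnorm⟩ := exists_three_real_embeddings K hTR hdeg
    have hbound : ∀ i, ρ i w ^ 2 ≤ 5 := fun i => by
      have := congrArg (fun x : 𝓞 K => ρ i x) hform
      simp only [map_add, map_mul, map_pow, map_sub, map_ofNat] at this
      nlinarith [sq_nonneg (2 * ρ i x + ρ i z), sq_nonneg (4 * ρ i y + ρ i z), sq_nonneg (ρ i z)]
    rcases exists_int_or_minpoly_eq_cubic hdeg w with ⟨n, rfl⟩ | ⟨a, b, c, hmin⟩
    · refine absurd hform (rational_form_ne hdeg ?_ _ _ _)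
      have := hbound 0
      simp only [map_intCast] at this
      exact_mod_cast this
    let F : ℤ[X] := X ^ 3 + C a * X ^ 2 + C b * X + C c
    have hF3 : F.natDegree = 3 := by simp only [F]; compute_degree!
    have hFm : F.Monic := by simp only [F]; monicity!
    have hminF : minpoly ℚ (w : K) = F.map (algebraMap ℤ ℚ) := by simp [hmin, F]
    have hevalF : ∀ r : ZMod 29, aeval r F = r ^ 3 + a * r ^ 2 + b * r + c := by simp [F]
    have hderF : ∀ r : ZMod 29, aeval r (derivative F) = 3 * r ^ 2 + 2 * a * r + b := fun r => by
      simp only [F, derivative_mul, derivative_C, derivative_X_pow, derivative_X,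
        map_add, map_mul, map_pow, aeval_X, aeval_C, map_zero, map_one, zero_mul, zero_add]
      simp
      ring
    have hwK : (w : K) ^ 3 + a * (w : K) ^ 2 + b * (w : K) + c = 0 := by
      have := minpoly.aeval ℚ (w : K)
      simpa [hmin] using this
    have hw : aeval w F = 0 := by
      apply RingOfIntegers.ext
      simpa [F] using hwK
    have hdegmin : (minpoly ℚ (w : K)).natDegree = 3 := by
      rw [hminF, hFm.natDegree_map, hF3]
    obtain ⟨pb, hpb⟩ := exists_powerBasis_gen_eq (F := ℚ) (w : K) (by rw [hdegmin, hdeg])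
    have hne : ∀ i j, i ≠ j → ρ i w ≠ ρ j w := fun i j hij he => hij <| hinj <| by
      have : (ρ i).toRatAlgHom = (ρ j).toRatAlgHom := pb.algHom_ext (by rw [hpb]; exact he)
      exact RingHom.ext fun x => DFunLike.congr_fun this x
    have hroot : ∀ i, ρ i w ^ 3 + a * ρ i w ^ 2 + b * ρ i w + c = 0 := fun i => by
      simpa using congrArg (ρ i) hwK
    obtain ⟨ha, hb, hc⟩ := vieta_cubic (hne 0 1 (by decide)) (hne 0 2 (by decide))
      (hne 1 2 (by decide)) (hroot 0) (hroot 1) (hroot 2)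
    rcases cubic_cases_of_roots (hbound 0) (hbound 1) (hbound 2) ha hb hc with
      ⟨t, ht⟩ | ⟨r, h0, h1, hr⟩ | ⟨hno, hN⟩ | ⟨rfl, rfl, hc⟩
    · have hirr := minpoly.irreducible (Algebra.IsIntegral.isIntegral (R := ℚ) (w : K))
      have hisroot : (minpoly ℚ (w : K)).IsRoot t := by
        simp only [hmin, IsRoot, eval_add, eval_mul, eval_pow, eval_X, eval_C]
        exact_mod_cast ht
      have := natDegree_eq_of_degree_eq_some (degree_eq_one_of_irreducible_of_root hirr hisroot)
      rw [hdegmin] at this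
      norm_num at this
    · exact absurd hform (form_ne_of_simple_root hdeg hF3 hminF (by rwa [hevalF])
        (by rwa [hderF]) hr _ _ _)
    · refine absurd hform (form_ne_of_norm_eq hnorm (fun A B =>
        dvd_of_dvd_two_mul_sq_add_sq hdeg hFm hF3 hw fun r => by rw [hevalF]; exact hno r) ?_ _ _ _)
      simpa only [map_pow, map_sub, map_ofNat] using hN
    · rcases hc with rfl | rfl
      · exact ⟨-w, by push_cast at hwK; linear_combination -hwK⟩
      · exact ⟨w, by push_cast at hwK; linear_combination hwK⟩
  · rintro ⟨β, hβ⟩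
    have hint : IsIntegral ℤ β := ⟨X ^ 3 - 4 * X - 1, by monicity!, by simpa using hβ⟩
    obtain ⟨w, rfl⟩ : ∃ w : 𝓞 K, (w : K) = β := ⟨⟨β, hint⟩, rfl⟩
    have hw : w ^ 3 - 4 * w - 1 = 0 := by
      apply RingOfIntegers.ext
      simpa only [map_sub, map_mul, map_pow, map_ofNat, map_one, map_zero] using hβ
    exact ⟨w, 4 - w - w ^ 2, -8 + 2 * w ^ 2, 1 - w, by linear_combination (-9 * w - 1) * hw⟩
end
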